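/- arXiv:2205.08162 — 7 statements merged into one kernel-verified Lean document; each statement's English description precedes it below -/
import Mathlib

section
/- Let U ⊆ ℍ be an axially symmetric open set not intersecting the real line, let 𝒰 = {(q₀,r) ∈ ℝ×(0,∞) : q₀ + 𝕊r ⊆ U}, and let A, B : 𝒰 → ℍ be twice continuously differentiable. Define f̃ : U → ℍ by f̃(q) = A(Re(q), |Im(q)|) + (Im(q)/|Im(q)|)·B(Re(q), |Im(q)|) (so f̃(q₀+rω) = A(q₀,r) + ωB(q₀,r) for ω ∈ 𝕊, r > 0). If f̃ is axially harmonic, i.e. Δf̃ = 0 on U, then for every (q₀,r) ∈ 𝒰 the functions A and B satisfy the second-order system: ∂²_{q₀}A(q₀,r) + ∂²_r A(q₀,r) + (2/r)∂_r A(q₀,r) = 0 and ∂²_{q₀}B(q₀,r) + ∂²_r B(q₀,r) + (2r∂_r B(q₀,r) − 2B(q₀,r))/r² = 0. -/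
noncomputable section

open Quaternion Finset

def e1 : Quaternion ℝ := ⟨0, 1, 0, 0⟩
def e2 : Quaternion ℝ := ⟨0, 0, 1, 0⟩
def e3 : Quaternion ℝ := ⟨0, 0, 0, 1⟩

/-- Left Fueter operator `Df = ∂₀f + e₁∂₁f + e₂∂₂f + e₃∂₃f` (real directional derivatives
along `1, e₁, e₂, e₃`). -/
def fueterL (f : Quaternion ℝ → Quaternion ℝ) (q : Quaternion ℝ) : Quaternion ℝ :=
  fderiv ℝ f q 1 + e1 * fderiv ℝ f q e1 + e2 * fderiv ℝ f q e2 + e3 * fderiv ℝ f q e3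

/-- Right Fueter operator `fD = ∂₀f + (∂₁f)e₁ + (∂₂f)e₂ + (∂₃f)e₃`. -/
def fueterR (f : Quaternion ℝ → Quaternion ℝ) (q : Quaternion ℝ) : Quaternion ℝ :=
  fderiv ℝ f q 1 + fderiv ℝ f q e1 * e1 + fderiv ℝ f q e2 * e2 + fderiv ℝ f q e3 * e3

/-- Second directional derivative along `v`. -/
def dir2 (f : Quaternion ℝ → Quaternion ℝ) (v q : Quaternion ℝ) : Quaternion ℝ :=
  fderiv ℝ (fun x => fderiv ℝ f x v) q v

/-- Laplacian in the four real coordinates of a quaternionic variable. -/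
def quatLaplacian (f : Quaternion ℝ → Quaternion ℝ) (q : Quaternion ℝ) : Quaternion ℝ :=
  dir2 f 1 q + dir2 f e1 q + dir2 f e2 q + dir2 f e3 q

/-- `Q_{c,s}(q) = s² − 2 Re(q) s + |q|²` (commutative pseudo Cauchy kernel denominator). -/
def Qcs (s q : Quaternion ℝ) : Quaternion ℝ :=
  s ^ 2 - 2 * (q.re : Quaternion ℝ) * s + ((‖q‖ ^ 2 : ℝ) : Quaternion ℝ)

/-- Left slice hyperholomorphic Cauchy kernel `S_L⁻¹(s,q) = (s − q̄) Q_{c,s}(q)⁻¹` (form II). -/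
def SL (s q : Quaternion ℝ) : Quaternion ℝ := (s - star q) * (Qcs s q)⁻¹

/-- Right slice hyperholomorphic Cauchy kernel `S_R⁻¹(s,q) = Q_{c,s}(q)⁻¹ (s − q̄)` (form II). -/
def SR (s q : Quaternion ℝ) : Quaternion ℝ := (Qcs s q)⁻¹ * (s - star q)

/-- Left F-kernel `F_L(s,q) = −4 (s − q̄) Q_{c,s}(q)⁻²`. -/
def FL (s q : Quaternion ℝ) : Quaternion ℝ := -4 * (s - star q) * ((Qcs s q) ^ 2)⁻¹

/-- Right F-kernel `F_R(s,q) = −4 Q_{c,s}(q)⁻² (s − q̄)`. -/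
def FR (s q : Quaternion ℝ) : Quaternion ℝ := -4 * ((Qcs s q) ^ 2)⁻¹ * (s - star q)

/-- Partial derivative in the first variable of a function `ℝ → ℝ → ℍ`. -/
def pd1 (F : ℝ → ℝ → Quaternion ℝ) (u v : ℝ) : Quaternion ℝ := deriv (fun t => F t v) u

/-- Partial derivative in the second variable of a function `ℝ → ℝ → ℍ`. -/
def pd2 (F : ℝ → ℝ → Quaternion ℝ) (u v : ℝ) : Quaternion ℝ := deriv (fun t => F u t) v

/-- The function `f̃(q) = A(Re q, |Im q|) + (Im q / |Im q|) B(Re q, |Im q|)`. -/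
def ftilde (A B : ℝ → ℝ → Quaternion ℝ) (q : Quaternion ℝ) : Quaternion ℝ :=
  A q.re ‖q.im‖ + ‖q.im‖⁻¹ • (q.im * B q.re ‖q.im‖)

open Topology Filter

@[simp]
theorem e1_components : e1.re = 0 ∧ e1.imI = 1 ∧ e1.imJ = 0 ∧ e1.imK = 0 :=
  ⟨rfl, rfl, rfl, rfl⟩

@[simp]
theorem e2_components : e2.re = 0 ∧ e2.imI = 0 ∧ e2.imJ = 1 ∧ e2.imK = 0 :=
  ⟨rfl, rfl, rfl, rfl⟩

@[simp]
theorem e3_components : e3.re = 0 ∧ e3.imI = 0 ∧ e3.imJ = 0 ∧ e3.imK = 1 :=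
  ⟨rfl, rfl, rfl, rfl⟩

theorem norm_e1 : ‖e1‖ = 1 := by
  rw [← sq_eq_sq₀ (norm_nonneg _) zero_le_one, sq, ← Quaternion.normSq_eq_norm_mul_self]
  simp [Quaternion.normSq_def']

section SecondDerivatives

variable {E : Type*} [NormedAddCommGroup E] [NormedSpace ℝ E]

theorem ContDiffAt.eventually_hasDerivAt_deriv {φ : ℝ → E} {a : ℝ} (h : ContDiffAt ℝ 2 φ a) :
    ∀ᶠ t in 𝓝 a, HasDerivAt φ (deriv φ t) t := by
  filter_upwards [h.eventually (by simp)] with t ht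
  exact (ht.differentiableAt (by simp)).hasDerivAt

theorem ContDiffAt.hasDerivAt_deriv_deriv {φ : ℝ → E} {a : ℝ} (h : ContDiffAt ℝ 2 φ a) :
    HasDerivAt (deriv φ) (deriv (deriv φ) a) a := by
  have h1 : ContDiffAt ℝ 1 (fun x => fderiv ℝ φ x) a := h.fderiv_right (by norm_num)
  have h2 : DifferentiableAt ℝ (fun x => fderiv ℝ φ x 1) a :=
    (h1.differentiableAt (by simp)).clm_apply (differentiableAt_const _)
  exact h2.hasDerivAt

theorem hasDerivAt_sqrt_sq_add_sq {r : ℝ} (hr : 0 < r) (t : ℝ) :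
    HasDerivAt (fun t => √(r ^ 2 + t ^ 2)) (t * (√(r ^ 2 + t ^ 2))⁻¹) t := by
  have h0 : r ^ 2 + t ^ 2 ≠ 0 := by positivity
  have h := ((hasDerivAt_pow 2 t).const_add (r ^ 2)).sqrt h0
  convert h using 1
  field_simp
  simp [mul_comm]

theorem tendsto_sqrt_sq_add_sq {r : ℝ} (hr : 0 < r) :
    Tendsto (fun t => √(r ^ 2 + t ^ 2)) (𝓝 0) (𝓝 r) := by
  have h := (hasDerivAt_sqrt_sq_add_sq hr 0).continuousAt.tendsto
  simpa [Real.sqrt_sq hr.le] using h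

theorem ContDiffAt.eventually_hasDerivAt_comp_sqrt {h : ℝ → E} {r : ℝ} (hr : 0 < r)
    (hh : ContDiffAt ℝ 2 h r) :
    ∀ᶠ t in 𝓝 (0 : ℝ), HasDerivAt (fun t => h (√(r ^ 2 + t ^ 2)))
      (t • ((√(r ^ 2 + t ^ 2))⁻¹ • deriv h (√(r ^ 2 + t ^ 2)))) t := by
  filter_upwards [(tendsto_sqrt_sq_add_sq hr).eventually hh.eventually_hasDerivAt_deriv] with t ht
  rw [smul_smul]
  exact ht.scomp t (hasDerivAt_sqrt_sq_add_sq hr t)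

theorem ContDiffAt.hasDerivAt_deriv_comp_sqrt {h : ℝ → E} {r : ℝ} (hr : 0 < r)
    (hh : ContDiffAt ℝ 2 h r) :
    HasDerivAt (fun t : ℝ => t • ((√(r ^ 2 + t ^ 2))⁻¹ • deriv h (√(r ^ 2 + t ^ 2))))
      (r⁻¹ • deriv h r) 0 := by
  have hs := hasDerivAt_sqrt_sq_add_sq hr 0
  have hs0 : √(r ^ 2 + 0 ^ 2) = r := by simp [Real.sqrt_sq hr.le]
  have hd : HasDerivAt (deriv h) (deriv (deriv h) r) (√(r ^ 2 + 0 ^ 2)) :=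
    hs0.symm ▸ hh.hasDerivAt_deriv_deriv
  have h1 := (hs.inv (by rw [hs0]; exact hr.ne')).smul (hd.scomp 0 hs)
  have h2 := (hasDerivAt_id (0 : ℝ)).smul h1
  refine h2.congr_deriv ?_
  simp [Real.sqrt_sq hr.le]

end SecondDerivatives

theorem dir2_eq_of_hasDerivAt {f : Quaternion ℝ → Quaternion ℝ} {v q : Quaternion ℝ}
    {g g' : ℝ → Quaternion ℝ} {a : ℝ} {d : Quaternion ℝ} (hf : ContDiffAt ℝ 2 f q)
    (hfg : ∀ᶠ t in 𝓝 a, f (q + (t - a) • v) = g t)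
    (hg : ∀ᶠ t in 𝓝 a, HasDerivAt g (g' t) t) (hg' : HasDerivAt g' d a) :
    dir2 f v q = d := by
  have hline : ∀ t : ℝ, HasDerivAt (fun t : ℝ => q + (t - a) • v) v t := fun t => by
    simpa using (((hasDerivAt_id t).sub_const a).smul_const v).const_add q
  have hq : q + (a - a) • v = q := by simp
  have htend : Tendsto (fun t : ℝ => q + (t - a) • v) (𝓝 a) (𝓝 q) := by
    simpa using (hline a).continuousAt.tendsto
  have hev : g' =ᶠ[𝓝 a] fun t => fderiv ℝ f (q + (t - a) • v) v := by
    filter_upwards [htend.eventually (hf.eventually (by simp)), hg, hfg.eventually_nhds]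
      with t ht hgt hfgt
    have h1 := (ht.differentiableAt (by simp)).hasFDerivAt.comp_hasDerivAt t (hline t)
    exact (hgt.congr_of_eventuallyEq hfgt).unique h1
  have h1 : ContDiffAt ℝ 1 (fun x => fderiv ℝ f x) q := hf.fderiv_right (by norm_num)
  have h2 : DifferentiableAt ℝ (fun x => fderiv ℝ f x v) (q + (a - a) • v) := by
    rw [hq]
    exact (h1.differentiableAt (by simp)).clm_apply (differentiableAt_const _)
  have h3 := h2.hasFDerivAt.comp_hasDerivAt a (hline a)
  rw [hq] at h3
  exact h3.unique (hg'.congr_of_eventuallyEq hev.symm)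

theorem ftilde_coe_add (A B : ℝ → ℝ → Quaternion ℝ) (u : ℝ) {v : Quaternion ℝ} (hv : v.re = 0) :
    ftilde A B (u + v) = A u ‖v‖ + v * (‖v‖⁻¹ • B u ‖v‖) := by
  have h1 : ((u : Quaternion ℝ) + v).re = u := by simp [hv]
  have h2 : ((u : Quaternion ℝ) + v).im = v := by ext <;> simp [hv]
  simp [ftilde, h1, h2]

theorem ftilde_coe_add_smul (A B : ℝ → ℝ → Quaternion ℝ) (u : ℝ) {r : ℝ} (hr : 0 < r)
    {J : Quaternion ℝ} (hJ : J.re = 0) (hJ1 : ‖J‖ = 1) :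
    ftilde A B (u + r • J) = A u r + J * B u r := by
  have h : ‖r • J‖ = r := by rw [norm_smul, hJ1, mul_one, Real.norm_of_nonneg hr.le]
  rw [ftilde_coe_add A B u (by simp [hJ]), h]
  simp [smul_smul, hr.ne']

theorem contDiffAt_ftilde {A B : ℝ → ℝ → Quaternion ℝ} {q : Quaternion ℝ} (hq : q.im ≠ 0)
    (hA : ContDiffAt ℝ 2 (fun p : ℝ × ℝ => A p.1 p.2) (q.re, ‖q.im‖))
    (hB : ContDiffAt ℝ 2 (fun p : ℝ × ℝ => B p.1 p.2) (q.re, ‖q.im‖)) :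
    ContDiffAt ℝ 2 (ftilde A B) q := by
  have hre : ContDiff ℝ 2 (fun q : Quaternion ℝ => q.re) := by
    let L : Quaternion ℝ →ₗ[ℝ] ℝ :=
      { toFun := fun q => q.re, map_add' := by simp, map_smul' := by simp }
    exact (LinearMap.toContinuousLinearMap L).contDiff
  have him : ContDiff ℝ 2 (fun q : Quaternion ℝ => q.im) := by
    let L : Quaternion ℝ →ₗ[ℝ] Quaternion ℝ :=
      { toFun := fun q => q.im, map_add' := by simp, map_smul' := by simp }
    exact (LinearMap.toContinuousLinearMap L).contDiff
  have hn : ContDiffAt ℝ 2 (fun q : Quaternion ℝ => ‖q.im‖) q := him.contDiffAt.norm ℝ hq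
  have hp : ContDiffAt ℝ 2 (fun q : Quaternion ℝ => (q.re, ‖q.im‖)) q := hre.contDiffAt.prodMk hn
  exact (hA.comp q hp).add ((hn.inv (norm_ne_zero_iff.2 hq)).smul
    (him.contDiffAt.mul (hB.comp q hp)))

section AxialLaplacian

variable {A B : ℝ → ℝ → Quaternion ℝ} {u r : ℝ} {J w : Quaternion ℝ}

theorem dir2_one_ftilde (hr : 0 < r) (hJ : J.re = 0) (hJ1 : ‖J‖ = 1)
    (hf : ContDiffAt ℝ 2 (ftilde A B) (u + r • J))
    (hA : ContDiffAt ℝ 2 (fun t => A t r) u) (hB : ContDiffAt ℝ 2 (fun t => B t r) u) :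
    dir2 (ftilde A B) 1 (u + r • J) = pd1 (pd1 A) u r + J * pd1 (pd1 B) u r := by
  refine dir2_eq_of_hasDerivAt (a := u) (g := fun t => A t r + J * B t r)
    (g' := fun t => pd1 A t r + J * pd1 B t r) hf (Eventually.of_forall fun t => ?_) ?_ ?_
  · rw [← ftilde_coe_add_smul A B t hr hJ hJ1]
    congr 1
    ext <;> simp [hJ]
  · filter_upwards [hA.eventually_hasDerivAt_deriv, hB.eventually_hasDerivAt_deriv] with t h1 h2
    exact h1.add (h2.const_mul J)
  · exact hA.hasDerivAt_deriv_deriv.add (hB.hasDerivAt_deriv_deriv.const_mul J)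

theorem dir2_radial_ftilde (hr : 0 < r) (hJ : J.re = 0) (hJ1 : ‖J‖ = 1)
    (hf : ContDiffAt ℝ 2 (ftilde A B) (u + r • J))
    (hA : ContDiffAt ℝ 2 (A u) r) (hB : ContDiffAt ℝ 2 (B u) r) :
    dir2 (ftilde A B) J (u + r • J) = pd2 (pd2 A) u r + J * pd2 (pd2 B) u r := by
  refine dir2_eq_of_hasDerivAt (a := r) (g := fun t => A u t + J * B u t)
    (g' := fun t => pd2 A u t + J * pd2 B u t) hf ?_ ?_ ?_
  · filter_upwards [lt_mem_nhds hr] with t ht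
    rw [← ftilde_coe_add_smul A B u ht hJ hJ1, add_assoc, ← add_smul, add_sub_cancel]
  · filter_upwards [hA.eventually_hasDerivAt_deriv, hB.eventually_hasDerivAt_deriv] with t h1 h2
    exact h1.add (h2.const_mul J)
  · exact hA.hasDerivAt_deriv_deriv.add (hB.hasDerivAt_deriv_deriv.const_mul J)

theorem dir2_tangential_ftilde (hr : 0 < r) (hJ : J.re = 0) (hw : w.re = 0)
    (hJw : ∀ t : ℝ, ‖r • J + t • w‖ = √(r ^ 2 + t ^ 2))
    (hf : ContDiffAt ℝ 2 (ftilde A B) (u + r • J))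
    (hA : ContDiffAt ℝ 2 (A u) r) (hB : ContDiffAt ℝ 2 (B u) r) :
    dir2 (ftilde A B) w (u + r • J) =
      r⁻¹ • pd2 A u r + J * (r⁻¹ • pd2 B u r - (r ^ 2)⁻¹ • B u r) := by
  set C : ℝ → Quaternion ℝ := fun s => s⁻¹ • B u s
  have hC : ContDiffAt ℝ 2 C r := (contDiffAt_inv ℝ hr.ne').smul hB
  have hC' : deriv C r = r⁻¹ • pd2 B u r - (r ^ 2)⁻¹ • B u r := by
    have h := (hasDerivAt_inv hr.ne').smul (hB.differentiableAt (by simp)).hasDerivAt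
    rw [HasDerivAt.deriv (f := C) h, neg_smul, ← sub_eq_add_neg]
    rfl
  have hl : ∀ t : ℝ, HasDerivAt (fun t : ℝ => r • J + t • w) w t := fun t => by
    simpa using ((hasDerivAt_id t).smul_const w).const_add (r • J)
  refine dir2_eq_of_hasDerivAt (a := 0)
    (g := fun t => A u (√(r ^ 2 + t ^ 2)) + (r • J + t • w) * C (√(r ^ 2 + t ^ 2)))
    (g' := fun t => t • ((√(r ^ 2 + t ^ 2))⁻¹ • deriv (A u) (√(r ^ 2 + t ^ 2))) +
      (w * C (√(r ^ 2 + t ^ 2)) + (r • J + t • w) *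
        (t • ((√(r ^ 2 + t ^ 2))⁻¹ • deriv C (√(r ^ 2 + t ^ 2))))))
    hf (Eventually.of_forall fun t => ?_) ?_ ?_
  · rw [sub_zero, add_assoc, ftilde_coe_add A B u (by simp [hJ, hw]), hJw]
  · filter_upwards [hA.eventually_hasDerivAt_comp_sqrt hr, hC.eventually_hasDerivAt_comp_sqrt hr]
      with t h1 h2
    exact h1.add ((hl t).mul h2)
  · have h0 := (hC.eventually_hasDerivAt_comp_sqrt hr).self_of_nhds
    have h1 := (hA.hasDerivAt_deriv_comp_sqrt hr).add
      ((h0.const_mul w).add ((hl 0).mul (hC.hasDerivAt_deriv_comp_sqrt hr)))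
    refine h1.congr_deriv ?_
    rw [← hC']
    simp [smul_smul, hr.ne', pd2]

theorem quatLaplacian_ftilde (hr : 0 < r) (hJ : J = e1 ∨ J = -e1)
    (hA : ContDiffAt ℝ 2 (fun p : ℝ × ℝ => A p.1 p.2) (u, r))
    (hB : ContDiffAt ℝ 2 (fun p : ℝ × ℝ => B p.1 p.2) (u, r)) :
    quatLaplacian (ftilde A B) (u + r • J) =
      (pd1 (pd1 A) u r + pd2 (pd2 A) u r + (2 / r) • pd2 A u r) +
      J * (pd1 (pd1 B) u r + pd2 (pd2 B) u r
        + (r ^ 2)⁻¹ • ((2 * r) • pd2 B u r - (2 : ℝ) • B u r)) := by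
  have hre : J.re = 0 := by rcases hJ with rfl | rfl <;> simp
  have hnorm : ‖J‖ = 1 := by
    rcases hJ with rfl | rfl <;> simp [norm_e1]
  have hn : ‖r • J‖ = r := by rw [norm_smul, hnorm, mul_one, Real.norm_of_nonneg hr.le]
  have hqre : ((u : Quaternion ℝ) + r • J).re = u := by simp [hre]
  have hqim : ((u : Quaternion ℝ) + r • J).im = r • J := by ext <;> simp [hre]
  have hf : ContDiffAt ℝ 2 (ftilde A B) (u + r • J) := by
    apply contDiffAt_ftilde
    · rw [hqim, ← norm_pos_iff, hn]
      exact hr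
    · rwa [hqre, hqim, hn]
    · rwa [hqre, hqim, hn]
  have hl1 : ContDiffAt ℝ 2 (fun t : ℝ => (t, r)) u := contDiffAt_id.prodMk contDiffAt_const
  have hl2 : ContDiffAt ℝ 2 (fun t : ℝ => (u, t)) r := contDiffAt_const.prodMk contDiffAt_id
  have hA1 : ContDiffAt ℝ 2 (fun t => A t r) u := (hA.comp (f := fun t => (t, r)) u hl1 :)
  have hB1 : ContDiffAt ℝ 2 (fun t => B t r) u := (hB.comp (f := fun t => (t, r)) u hl1 :)
  have hA2 : ContDiffAt ℝ 2 (A u) r := (hA.comp (f := fun t => (u, t)) r hl2 :)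
  have hB2 : ContDiffAt ℝ 2 (B u) r := (hB.comp (f := fun t => (u, t)) r hl2 :)
  have hrad : dir2 (ftilde A B) e1 (u + r • J) = dir2 (ftilde A B) J (u + r • J) := by
    rcases hJ with rfl | rfl
    · rfl
    · simp [dir2, fderiv_fun_neg]
  have hsqrt : ∀ w : Quaternion ℝ, w = e2 ∨ w = e3 → ∀ t : ℝ,
      ‖r • J + t • w‖ = √(r ^ 2 + t ^ 2) := by
    intro w hw t
    rw [eq_comm, Real.sqrt_eq_iff_mul_self_eq (by positivity) (norm_nonneg _),
      ← Quaternion.normSq_eq_norm_mul_self]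
    rcases hJ with rfl | rfl <;> rcases hw with rfl | rfl <;>
      simp [Quaternion.normSq_def']
  rw [quatLaplacian, hrad, dir2_one_ftilde hr hre hnorm hf hA1 hB1,
    dir2_radial_ftilde hr hre hnorm hf hA2 hB2,
    dir2_tangential_ftilde hr hre (w := e2) (by simp) (hsqrt _ (Or.inl rfl)) hf hA2 hB2,
    dir2_tangential_ftilde hr hre (w := e3) (by simp) (hsqrt _ (Or.inr rfl)) hf hA2 hB2]
  have h1 : (r ^ 2)⁻¹ * (2 * r) = 2 * r⁻¹ := by field_simp
  simp only [smul_sub, smul_smul, h1, mul_add, mul_sub, mul_smul_comm, div_eq_mul_inv]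
  module

end AxialLaplacian

/-- If `f̃(q) = A(q₀,r) + ωB(q₀,r)` is axially harmonic on an axially symmetric open set `U`
not intersecting the real line, then `A` and `B` satisfy the stated second order system. -/
theorem second_order_system_of_axially_harmonic
    (U : Set (Quaternion ℝ)) (hopen : IsOpen U)
    (hax : ∀ (u v : ℝ) (J : Quaternion ℝ), J.re = 0 → ‖J‖ = 1 →
      (u : Quaternion ℝ) + v • J ∈ U →
      ∀ J' : Quaternion ℝ, J'.re = 0 → ‖J'‖ = 1 → (u : Quaternion ℝ) + v • J' ∈ U)
    (hnoreal : ∀ q ∈ U, q.im ≠ 0)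
    (A B : ℝ → ℝ → Quaternion ℝ)
    (𝒰 : Set (ℝ × ℝ))
    (h𝒰 : 𝒰 = {p : ℝ × ℝ | 0 < p.2 ∧ ∀ J : Quaternion ℝ, J.re = 0 → ‖J‖ = 1 →
      (p.1 : Quaternion ℝ) + p.2 • J ∈ U})
    (hA : ContDiffOn ℝ 2 (fun p : ℝ × ℝ => A p.1 p.2) 𝒰)
    (hB : ContDiffOn ℝ 2 (fun p : ℝ × ℝ => B p.1 p.2) 𝒰)
    (hharm : ∀ q ∈ U, quatLaplacian (ftilde A B) q = 0) :
    ∀ p ∈ 𝒰,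
      pd1 (pd1 A) p.1 p.2 + pd2 (pd2 A) p.1 p.2 + (2 / p.2) • pd2 A p.1 p.2 = 0 ∧
      pd1 (pd1 B) p.1 p.2 + pd2 (pd2 B) p.1 p.2
        + (p.2 ^ 2)⁻¹ • ((2 * p.2) • pd2 B p.1 p.2 - (2 : ℝ) • B p.1 p.2) = 0 := by
  intro p hp
  have hmem : ∀ J : Quaternion ℝ, J = e1 ∨ J = -e1 → (p.1 : Quaternion ℝ) + p.2 • J ∈ U := by
    rw [h𝒰] at hp
    rintro J (rfl | rfl)
    · exact hp.2 _ rfl norm_e1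
    · exact hp.2 _ (by simp) (by rw [norm_neg, norm_e1])
  have hr : 0 < p.2 := by
    rw [h𝒰] at hp
    exact hp.1
  have hnhds : 𝒰 ∈ 𝓝 p := by
    have hcont : Continuous fun x : ℝ × ℝ => (x.1 : Quaternion ℝ) + x.2 • e1 :=
      (Quaternion.continuous_coe.comp continuous_fst).add (continuous_snd.smul continuous_const)
    filter_upwards [hcont.continuousAt.preimage_mem_nhds (hopen.mem_nhds (hmem e1 (Or.inl rfl))),
      continuous_snd.continuousAt.preimage_mem_nhds (lt_mem_nhds hr)] with x hx hx2
    rw [h𝒰]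
    exact ⟨hx2, hax x.1 x.2 e1 rfl norm_e1 hx⟩
  have hlap : ∀ J : Quaternion ℝ, J = e1 ∨ J = -e1 → _ := fun J hJ =>
    (quatLaplacian_ftilde hr hJ (hA.contDiffAt hnhds) (hB.contDiffAt hnhds)).symm.trans
      (hharm _ (hmem J hJ))
  have hplus := hlap e1 (Or.inl rfl)
  have hminus := hlap (-e1) (Or.inr rfl)
  rw [neg_mul] at hminus
  have hzero : e1 * (pd1 (pd1 B) p.1 p.2 + pd2 (pd2 B) p.1 p.2
      + (p.2 ^ 2)⁻¹ • ((2 * p.2) • pd2 B p.1 p.2 - (2 : ℝ) • B p.1 p.2)) = 0 := by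
    rw [← sub_eq_add_neg, sub_eq_zero] at hminus
    rw [hminus, ← two_smul ℝ] at hplus
    exact (smul_eq_zero.1 hplus).resolve_left two_ne_zero
  rw [hzero, add_zero] at hplus
  exact ⟨hplus, (mul_eq_zero.1 hzero).resolve_left (norm_ne_zero_iff.1 (by simp [norm_e1]))⟩
end
end

section
/- Let s, q ∈ ℍ be such that Q_{c,s}(q) ≠ 0 (i.e. q ∉ [s]). Then F_L(s,q)·s − q·F_L(s,q) = −4·Q_{c,s}(q)^{−1}, and s·F_R(s,q) − F_R(s,q)·q = −4·Q_{c,s}(q)^{−1}. -/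
noncomputable section

open Quaternion Finset

theorem Qcs_eq_left (s q : Quaternion ℝ) :
    (s - star q) * s - q * (s - star q) = Qcs s q := by
  have h₁ : 2 * (q.re : Quaternion ℝ) = q + star q := (Quaternion.self_add_star q).symm
  have h₂ : q * star q = ((‖q‖ ^ 2 : ℝ) : Quaternion ℝ) := by
    rw [Quaternion.self_mul_star, Quaternion.normSq_eq_norm_mul_self, sq]
  rw [Qcs, ← h₂, h₁]
  noncomm_ring

theorem commute_Qcs (s q : Quaternion ℝ) : Commute s (Qcs s q) := by
  have hre : Commute s (q.re : Quaternion ℝ) := (Quaternion.coe_commute q.re s).symm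
  exact (((Commute.refl s).pow_right 2).sub_right
    (((Commute.ofNat_right s 2).mul_right hre).mul_right (Commute.refl s))).add_right
    (Quaternion.coe_commute _ s).symm

theorem Qcs_eq_right (s q : Quaternion ℝ) :
    s * (s - star q) - (s - star q) * q = Qcs s q := by
  have h₁ : 2 * (q.re : Quaternion ℝ) = q + star q := (Quaternion.self_add_star q).symm
  have h₂ : star q * q = ((‖q‖ ^ 2 : ℝ) : Quaternion ℝ) := by
    rw [Quaternion.star_mul_self, Quaternion.normSq_eq_norm_mul_self, sq]
  have h₃ : 2 * (q.re : Quaternion ℝ) * s = s * (2 * (q.re : Quaternion ℝ)) :=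
    ((Commute.ofNat_right s 2).mul_right (Quaternion.coe_commute q.re s).symm).eq.symm
  rw [Qcs, ← h₂, h₃, h₁]
  noncomm_ring

/-- Relation between the F-kernels and the commutative pseudo Cauchy kernel:
`F_L(s,q)s − qF_L(s,q) = −4 Q_{c,s}(q)⁻¹` and `sF_R(s,q) − F_R(s,q)q = −4 Q_{c,s}(q)⁻¹`. -/
theorem Fkernel_relation (s q : Quaternion ℝ) (h : Qcs s q ≠ 0) :
    FL s q * s - q * FL s q = -4 * (Qcs s q)⁻¹ ∧
    s * FR s q - FR s q * q = -4 * (Qcs s q)⁻¹ := by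
  have hP : Commute s ((Qcs s q) ^ 2)⁻¹ := ((commute_Qcs s q).pow_right 2).inv_right₀
  have hQl : Qcs s q * ((Qcs s q) ^ 2)⁻¹ = (Qcs s q)⁻¹ := by
    rw [sq, mul_inv_rev, mul_inv_cancel_left₀ h]
  have hQr : ((Qcs s q) ^ 2)⁻¹ * Qcs s q = (Qcs s q)⁻¹ := by
    rw [sq, mul_inv_rev, inv_mul_cancel_right₀ h]
  constructor
  · calc
      FL s q * s - q * FL s q
          = -4 * ((s - star q) * (((Qcs s q) ^ 2)⁻¹ * s)
              - q * (s - star q) * ((Qcs s q) ^ 2)⁻¹) := by rw [FL]; noncomm_ring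
      _ = -4 * (((s - star q) * s - q * (s - star q)) * ((Qcs s q) ^ 2)⁻¹) := by
        rw [← hP.eq]; noncomm_ring
      _ = -4 * (Qcs s q)⁻¹ := by rw [Qcs_eq_left, hQl]
  · calc
      s * FR s q - FR s q * q
          = -4 * (s * ((Qcs s q) ^ 2)⁻¹ * (s - star q)
              - ((Qcs s q) ^ 2)⁻¹ * (s - star q) * q) := by rw [FR]; noncomm_ring
      _ = -4 * (((Qcs s q) ^ 2)⁻¹ * (s * (s - star q) - (s - star q) * q)) := by
        rw [hP.eq]; noncomm_ring
      _ = -4 * (Qcs s q)⁻¹ := by rw [Qcs_eq_right, hQr]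
end
end

section
/- For every integer n ≥ 1 and every q ∈ ℍ, the Fueter operator applied to the power function x ↦ xⁿ at q satisfies D(xⁿ)(q) = (xⁿ)D(q) = −2·∑_{k=1}^{n} q^{n−k}·q̄^{k−1}; in particular this value is a real multiple of 1 (it equals its own quaternionic conjugate). -/
noncomputable section

open Quaternion Finset

/-- The derivative of `x ↦ xⁿ` on the quaternions in the direction `v`. -/
theorem Quaternion.fderiv_pow_apply (n : ℕ) (q v : Quaternion ℝ) :
    fderiv ℝ (fun x : Quaternion ℝ => x ^ n) q v =
      ∑ k ∈ Finset.range n, q ^ (n - 1 - k) * v * q ^ k := by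
  have h : HasFDerivAt (fun x : Quaternion ℝ => x ^ n) _ q :=
    (hasFDerivAt_id (𝕜 := ℝ) q).fun_pow' n
  rw [h.fderiv]
  simp [mul_assoc]

theorem add_sum_unit_mul_mul_unit (a : Quaternion ℝ) :
    a + e1 * a * e1 + e2 * a * e2 + e3 * a * e3 = -2 * star a := by
  have h : (-2 : Quaternion ℝ) * star a = (-2 : ℝ) • star a := by
    rw [Algebra.smul_def, map_neg, map_ofNat]
  rw [h]
  ext <;>
    simp only [Quaternion.re_add, Quaternion.imI_add, Quaternion.imJ_add, Quaternion.imK_add,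
      Quaternion.re_mul, Quaternion.imI_mul, Quaternion.imJ_mul, Quaternion.imK_mul,
      Quaternion.re_smul, Quaternion.imI_smul, Quaternion.imJ_smul, Quaternion.imK_smul,
      Quaternion.re_star, Quaternion.imI_star, Quaternion.imJ_star, Quaternion.imK_star,
      smul_eq_mul] <;>
    simp only [e1, e2, e3] <;>
    ring

/-- The left Fueter operator applied to `x ↦ xⁿ`, before commuting the factors. -/
theorem fueterL_pow (n : ℕ) (q : Quaternion ℝ) :
    fueterL (fun x => x ^ n) q =
      -2 * ∑ k ∈ Finset.range n, (star q) ^ (n - 1 - k) * q ^ k := by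
  simp only [fueterL, Quaternion.fderiv_pow_apply, Finset.mul_sum, ← Finset.sum_add_distrib]
  refine Finset.sum_congr rfl fun k _ => ?_
  rw [← star_pow, ← mul_assoc (-2), ← add_sum_unit_mul_mul_unit]
  simp only [add_mul, mul_assoc, mul_one]

theorem fueterR_pow (n : ℕ) (q : Quaternion ℝ) :
    fueterR (fun x => x ^ n) q =
      -2 * ∑ k ∈ Finset.range n, q ^ (n - 1 - k) * (star q) ^ k := by
  simp only [fueterR, Quaternion.fderiv_pow_apply, Finset.mul_sum, Finset.sum_mul,
    ← Finset.sum_add_distrib]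
  refine Finset.sum_congr rfl fun k _ => ?_
  have h : (-2 : Quaternion ℝ) * (q ^ (n - 1 - k) * star q ^ k) =
      q ^ (n - 1 - k) * (-2 * star (q ^ k)) := by
    rw [star_pow, ← mul_assoc, ← mul_assoc, ((Commute.ofNat_left 2 _).neg_left).eq]
  rw [h, ← add_sum_unit_mul_mul_unit]
  simp only [mul_add, mul_assoc, mul_one]

theorem star_pow_commute_pow (q : Quaternion ℝ) (i j : ℕ) : Commute (star q ^ i) (q ^ j) :=
  Commute.pow_pow (star_comm_self' q) i j

theorem sum_star_pow_mul_pow (n : ℕ) (q : Quaternion ℝ) :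
    ∑ k ∈ Finset.range n, (star q) ^ (n - 1 - k) * q ^ k =
      ∑ k ∈ Finset.range n, q ^ (n - 1 - k) * (star q) ^ k := by
  rw [← Finset.sum_range_reflect]
  refine Finset.sum_congr rfl fun k hk => ?_
  have hk' : n - 1 - (n - 1 - k) = k := by
    have := Finset.mem_range.mp hk
    omega
  rw [hk', (star_pow_commute_pow q _ _).eq]

/-- For `n ≥ 1`, `D(xⁿ)(q) = (xⁿ)D(q) = −2 ∑_{k=1}^{n} q^{n−k} q̄^{k−1}`, and this value is
real (it equals its own quaternionic conjugate). -/
theorem fueter_pow (n : ℕ) (hn : 1 ≤ n) (q : Quaternion ℝ) :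
    fueterL (fun x => x ^ n) q = -2 * ∑ k ∈ Finset.range n, q ^ (n - 1 - k) * (star q) ^ k ∧
    fueterR (fun x => x ^ n) q = -2 * ∑ k ∈ Finset.range n, q ^ (n - 1 - k) * (star q) ^ k ∧
    star (fueterL (fun x => x ^ n) q) = fueterL (fun x => x ^ n) q := by
  have hL := (fueterL_pow n q).trans (congrArg _ (sum_star_pow_mul_pow n q))
  refine ⟨hL, fueterR_pow n q, ?_⟩
  have h2 : star (-2 : Quaternion ℝ) = -2 := by simp
  have hsum : star (∑ k ∈ Finset.range n, q ^ (n - 1 - k) * (star q) ^ k) =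
      ∑ k ∈ Finset.range n, q ^ (n - 1 - k) * (star q) ^ k := by
    rw [star_sum, ← sum_star_pow_mul_pow n q]
    refine Finset.sum_congr rfl fun k _ => ?_
    rw [(star_pow_commute_pow q _ _).eq]
    simp
  rw [hL, star_mul, h2, hsum, ((Commute.ofNat_left 2 _).neg_left).eq]
end
end

section
/- Let s, q ∈ ℍ with |q| < |s|. Then Q_{c,s}(q) = s² − 2Re(q)s + |q|² is invertible and (s² − 2Re(q)s + |q|²)^{−1} = ∑_{m=1}^{∞} ∑_{k=1}^{m} q^{m−k}·q̄^{k−1}·s^{−1−m} = ∑_{m=1}^{∞} ∑_{k=1}^{m} s^{−1−m}·q^{m−k}·q̄^{k−1}, where both series converge absolutely. -/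
noncomputable section

open Quaternion Finset

/-- The real numbers `U m` with `∑_{k ≤ m} q ^ (m - k) * q̄ ^ k = U m`, given by the recurrence with
characteristic polynomial `x² - 2 Re(q) x + |q|²`. -/
def fueterCoeff (q : Quaternion ℝ) : ℕ → ℝ
  | 0 => 1
  | 1 => 2 * q.re
  | m + 2 => 2 * q.re * fueterCoeff q (m + 1) - ‖q‖ ^ 2 * fueterCoeff q m

lemma sum_pow_mul_star_pow_succ (q : Quaternion ℝ) (m : ℕ) :
    ∑ k ∈ Finset.range (m + 2), q ^ (m + 1 - k) * (star q) ^ k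
      = q * (∑ k ∈ Finset.range (m + 1), q ^ (m - k) * (star q) ^ k) + (star q) ^ (m + 1) := by
  rw [Finset.sum_range_succ, Finset.mul_sum]
  congr 1
  · refine Finset.sum_congr rfl fun k hk => ?_
    have hkm : m + 1 - k = (m - k) + 1 := by have := Finset.mem_range.mp hk; omega
    rw [hkm, pow_succ', mul_assoc]
  · simp

lemma sum_pow_mul_star_pow_eq_coe (q : Quaternion ℝ) (m : ℕ) :
    ∑ k ∈ Finset.range (m + 1), q ^ (m - k) * (star q) ^ k = (fueterCoeff q m : Quaternion ℝ) := by
  have hstar : star q = ((2 * q.re : ℝ) : Quaternion ℝ) - q := by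
    rw [eq_sub_iff_add_eq, Quaternion.star_add_self']
  have hmul : q * star q = ((‖q‖ ^ 2 : ℝ) : Quaternion ℝ) := by
    rw [Quaternion.self_mul_star, Quaternion.normSq_eq_norm_mul_self, pow_two]
  induction m using Nat.twoStepInduction with
  | zero => simp [fueterCoeff]
  | one => simp [Finset.sum_range_succ, fueterCoeff, hstar]
  | more m ih₀ ih₁ =>
    have hpow : (star q) ^ (m + 1)
        = (fueterCoeff q (m + 1) : Quaternion ℝ) - q * (fueterCoeff q m : Quaternion ℝ) := by
      rw [← ih₁, ← ih₀, sum_pow_mul_star_pow_succ, add_sub_cancel_left]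
    rw [sum_pow_mul_star_pow_succ, ih₁, pow_succ, hpow, sub_mul, mul_assoc q,
      (Quaternion.coe_commutes (fueterCoeff q m) (star q)), ← mul_assoc, hmul,
      (Quaternion.coe_commutes (fueterCoeff q (m + 1)) (star q)), hstar, sub_mul, fueterCoeff]
    push_cast
    abel

lemma abs_fueterCoeff_le (q : Quaternion ℝ) (m : ℕ) :
    |fueterCoeff q m| ≤ (m + 1) * ‖q‖ ^ m := by
  rw [← Real.norm_eq_abs, ← Quaternion.norm_coe, ← sum_pow_mul_star_pow_eq_coe]
  refine (norm_sum_le_of_le _ (f := fun k => q ^ (m - k) * (star q) ^ k)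
    (n := fun _ => ‖q‖ ^ m) fun k hk => ?_).trans (by simp)
  rw [norm_mul, norm_pow, norm_pow, norm_star, ← pow_add,
    Nat.sub_add_cancel (Nat.lt_succ_iff.mp (Finset.mem_range.mp hk))]

lemma summable_norm_fueterCoeff_smul {s q : Quaternion ℝ} (h : ‖q‖ < ‖s‖) :
    Summable fun m : ℕ => ‖fueterCoeff q m • (s⁻¹) ^ (m + 2)‖ := by
  have hs : 0 < ‖s‖ := (norm_nonneg q).trans_lt h
  have hr : ‖‖q‖ * ‖s‖⁻¹‖ < 1 := by
    rw [Real.norm_of_nonneg (by positivity), ← div_eq_mul_inv]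
    exact (div_lt_one hs).mpr h
  have hsum : Summable fun m : ℕ =>
      ((m : ℝ) ^ 1 * (‖q‖ * ‖s‖⁻¹) ^ m + (‖q‖ * ‖s‖⁻¹) ^ m) * ‖s‖⁻¹ ^ 2 :=
    ((summable_pow_mul_geometric_of_norm_lt_one 1 hr).add
      (summable_geometric_of_norm_lt_one hr)).mul_right _
  refine hsum.of_nonneg_of_le (fun _ => norm_nonneg _) fun m => ?_
  rw [norm_smul, norm_pow, norm_inv, Real.norm_eq_abs]
  calc |fueterCoeff q m| * ‖s‖⁻¹ ^ (m + 2)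
      ≤ ((m + 1) * ‖q‖ ^ m) * ‖s‖⁻¹ ^ (m + 2) := by
        gcongr
        exact abs_fueterCoeff_le q m
    _ = _ := by ring

lemma Qcs_mul_inv_pow {s : Quaternion ℝ} (hs : s ≠ 0) (q : Quaternion ℝ) (m : ℕ) :
    Qcs s q * (s⁻¹) ^ (m + 2)
      = (s⁻¹) ^ m - (2 * q.re) • (s⁻¹) ^ (m + 1) + (‖q‖ ^ 2) • (s⁻¹) ^ (m + 2) := by
  have h₁ (n : ℕ) : s * (s⁻¹) ^ (n + 1) = (s⁻¹) ^ n := by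
    rw [pow_succ', mul_inv_cancel_left₀ hs]
  have h₂ : (2 : Quaternion ℝ) * (q.re : Quaternion ℝ) = ((2 * q.re : ℝ) : Quaternion ℝ) := by
    push_cast; rfl
  rw [Qcs, h₂, add_mul, sub_mul, mul_assoc, h₁, pow_two s, mul_assoc, h₁, h₁,
    Quaternion.coe_mul_eq_smul, Quaternion.coe_mul_eq_smul]

lemma Qcs_mul_sum_fueterCoeff_smul {s : Quaternion ℝ} (hs : s ≠ 0) (q : Quaternion ℝ) (n : ℕ) :
    Qcs s q * ∑ m ∈ Finset.range (n + 1), fueterCoeff q m • (s⁻¹) ^ (m + 2)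
      = 1 - fueterCoeff q (n + 1) • (s⁻¹) ^ (n + 1)
        + (‖q‖ ^ 2) • fueterCoeff q n • (s⁻¹) ^ (n + 2) := by
  induction n with
  | zero => simpa [fueterCoeff] using Qcs_mul_inv_pow hs q 0
  | succ n ih =>
    rw [Finset.sum_range_succ, mul_add, ih, mul_smul_comm, Qcs_mul_inv_pow hs, fueterCoeff]
    module

lemma Qcs_mul_tsum_fueterCoeff_smul {s q : Quaternion ℝ} (h : ‖q‖ < ‖s‖) :
    Qcs s q * ∑' m : ℕ, fueterCoeff q m • (s⁻¹) ^ (m + 2) = 1 := by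
  have hs : s ≠ 0 := norm_pos_iff.mp ((norm_nonneg q).trans_lt h)
  have hsum := (summable_norm_fueterCoeff_smul h).of_norm
  have hzero := hsum.tendsto_atTop_zero
  have hpartial := ((hsum.hasSum.tendsto_sum_nat).comp
    (Filter.tendsto_add_atTop_nat 1)).const_mul (Qcs s q)
  have hshift : Filter.Tendsto (fun n : ℕ => fueterCoeff q (n + 1) • (s⁻¹) ^ (n + 1))
      Filter.atTop (nhds 0) := by
    have := (hzero.comp (Filter.tendsto_add_atTop_nat 1)).mul_const (s ^ 2)
    rw [zero_mul] at this
    refine this.congr fun n => ?_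
    rw [Function.comp_apply, smul_mul_assoc, pow_add _ (n + 1) 2, mul_assoc, inv_pow s 2,
      inv_mul_cancel₀ (pow_ne_zero 2 hs), mul_one]
  have hlim := (hshift.const_sub 1).add (hzero.const_smul (‖q‖ ^ 2))
  rw [sub_zero, smul_zero, add_zero] at hlim
  exact tendsto_nhds_unique hpartial
    (hlim.congr fun n => (Qcs_mul_sum_fueterCoeff_smul hs q n).symm)

/-- For `|q| < |s|` the quaternion `Q_{c,s}(q) = s² − 2Re(q)s + |q|²` is invertible and its
inverse is given by the two absolutely convergent series
`∑_{m=1}^∞ ∑_{k=1}^m q^{m−k} q̄^{k−1} s^{−1−m} = ∑_{m=1}^∞ ∑_{k=1}^m s^{−1−m} q^{m−k} q̄^{k−1}`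
(reindexed here with `m ∈ ℕ` replacing `m + 1` of the paper). -/
theorem Qcs_inv_series (s q : Quaternion ℝ) (h : ‖q‖ < ‖s‖) :
    Qcs s q ≠ 0 ∧
    Summable (fun m : ℕ =>
      ‖(∑ k ∈ Finset.range (m + 1), q ^ (m - k) * (star q) ^ k) * (s⁻¹) ^ (m + 2)‖) ∧
    Summable (fun m : ℕ =>
      ‖(s⁻¹) ^ (m + 2) * ∑ k ∈ Finset.range (m + 1), q ^ (m - k) * (star q) ^ k‖) ∧
    (Qcs s q)⁻¹
      = ∑' m : ℕ, (∑ k ∈ Finset.range (m + 1), q ^ (m - k) * (star q) ^ k) * (s⁻¹) ^ (m + 2) ∧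
    (Qcs s q)⁻¹
      = ∑' m : ℕ, (s⁻¹) ^ (m + 2) * ∑ k ∈ Finset.range (m + 1), q ^ (m - k) * (star q) ^ k := by
  have hleft (m : ℕ) :
      (∑ k ∈ Finset.range (m + 1), q ^ (m - k) * (star q) ^ k) * (s⁻¹) ^ (m + 2)
        = fueterCoeff q m • (s⁻¹) ^ (m + 2) := by
    rw [sum_pow_mul_star_pow_eq_coe, Quaternion.coe_mul_eq_smul]
  have hright (m : ℕ) :
      (s⁻¹) ^ (m + 2) * ∑ k ∈ Finset.range (m + 1), q ^ (m - k) * (star q) ^ k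
        = fueterCoeff q m • (s⁻¹) ^ (m + 2) := by
    rw [sum_pow_mul_star_pow_eq_coe, Quaternion.mul_coe_eq_smul]
  simp only [hleft, hright]
  have hone := Qcs_mul_tsum_fueterCoeff_smul h
  have hsum := summable_norm_fueterCoeff_smul h
  have hinv := inv_eq_of_mul_eq_one_right hone
  exact ⟨left_ne_zero_of_mul_eq_one hone, hsum, hsum, hinv, hinv⟩
end
end

section
/- Fix s ∈ ℍ. The function q ↦ D S_L^{−1}(s,q) = −2(s² − 2Re(q)s + |q|²)^{−1} is harmonic in the four real components of q; that is, at every q ∈ ℍ with Q_{c,s}(q) ≠ 0 the Laplacian Δ_q of the map q ↦ (s² − 2Re(q)s + |q|²)^{−1} vanishes. -/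
noncomputable section

open Quaternion Finset

theorem inner_eq_sum_components (x y : Quaternion ℝ) :
    inner ℝ x y = x.re * y.re + x.imI * y.imI + x.imJ * y.imJ + x.imK * y.imK := by
  simp [Quaternion.inner_def]

/-- The derivative of `Qcs s` at `x` in the direction `v`. -/
def qcsDeriv (s v x : Quaternion ℝ) : Quaternion ℝ :=
  (2 * inner ℝ x v) • (1 : Quaternion ℝ) - (2 * v.re) • s

theorem Qcs_eq_smul (s x : Quaternion ℝ) :
    Qcs s x = s ^ 2 - (2 * inner ℝ 1 x) • s + (‖x‖ ^ 2) • (1 : Quaternion ℝ) := by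
  have h1 : inner ℝ 1 x = x.re := by simp [Quaternion.inner_def]
  have h2 : (2 : Quaternion ℝ) = ((2 : ℝ) : Quaternion ℝ) := rfl
  rw [Qcs, h1, h2, ← Quaternion.coe_mul, Quaternion.coe_mul_eq_smul,
    ← Quaternion.coe_mul_eq_smul (‖x‖ ^ 2), mul_one]

theorem exists_hasFDerivAt_Qcs (s x : Quaternion ℝ) :
    ∃ L : Quaternion ℝ →L[ℝ] Quaternion ℝ,
      HasFDerivAt (Qcs s) L x ∧ ∀ v, L v = qcsDeriv s v x := by
  have h1 : HasFDerivAt (fun y : Quaternion ℝ => (2 * inner ℝ 1 y : ℝ))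
      ((2 : ℝ) • innerSL ℝ (1 : Quaternion ℝ)) x :=
    ((2 : ℝ) • innerSL ℝ (1 : Quaternion ℝ)).hasFDerivAt
  have h2 := (hasStrictFDerivAt_norm_sq x).hasFDerivAt
  have h3 := ((h1.smul_const s).const_sub (s ^ 2)).add (h2.smul_const (1 : Quaternion ℝ))
  refine ⟨_, h3.congr_of_eventuallyEq (.of_forall (Qcs_eq_smul s)), fun v => ?_⟩
  simp [qcsDeriv, inner_eq_sum_components]
  module

theorem exists_hasFDerivAt_qcsDeriv (s v x : Quaternion ℝ) :
    ∃ L : Quaternion ℝ →L[ℝ] Quaternion ℝ,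
      HasFDerivAt (qcsDeriv s v) L x ∧ ∀ w, L w = (2 * inner ℝ v w) • (1 : Quaternion ℝ) := by
  have h1 : HasFDerivAt (fun y : Quaternion ℝ => (2 * inner ℝ y v : ℝ))
      ((2 : ℝ) • innerSL ℝ v) x := by
    simp_rw [real_inner_comm v]
    exact ((2 : ℝ) • innerSL ℝ v).hasFDerivAt
  exact ⟨_, (h1.smul_const 1).sub_const _, fun w => by simp⟩

theorem exists_hasFDerivAt_inv_Qcs (s x : Quaternion ℝ) (h : Qcs s x ≠ 0) :
    ∃ L : Quaternion ℝ →L[ℝ] Quaternion ℝ, HasFDerivAt (fun y => (Qcs s y)⁻¹) L x ∧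
      ∀ v, L v = -((Qcs s x)⁻¹ * qcsDeriv s v x * (Qcs s x)⁻¹) := by
  obtain ⟨L, hL, hv⟩ := exists_hasFDerivAt_Qcs s x
  exact ⟨_, (hasFDerivAt_inv' (𝕜 := ℝ) h).comp x hL, fun v => by simp [hv]⟩

theorem commute_qcsDeriv_Qcs (s v x : Quaternion ℝ) : Commute (qcsDeriv s v x) (Qcs s x) := by
  have hs : Commute s (Qcs s x) := by
    rw [Qcs_eq_smul]
    exact (((Commute.refl s).pow_right 2).sub_right ((Commute.refl s).smul_right _)).add_right
      ((Commute.one_right s).smul_right _)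
  exact ((Commute.one_left _).smul_left _).sub_left (hs.smul_left _)

theorem dir2_inv_Qcs (s v q : Quaternion ℝ) (h : Qcs s q ≠ 0) :
    dir2 (fun x => (Qcs s x)⁻¹) v q =
      (2 * qcsDeriv s v q ^ 2 * (Qcs s q)⁻¹ - (2 * inner ℝ v v) • (1 : Quaternion ℝ)) *
        ((Qcs s q)⁻¹) ^ 2 := by
  obtain ⟨LQ, hLQ, -⟩ := exists_hasFDerivAt_Qcs s q
  obtain ⟨LA, hLA, hA⟩ := exists_hasFDerivAt_qcsDeriv s v q
  obtain ⟨LP, hLP, hP⟩ := exists_hasFDerivAt_inv_Qcs s q h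
  have hev : (fun x => fderiv ℝ (fun y => (Qcs s y)⁻¹) x v) =ᶠ[nhds q]
      fun x => -((Qcs s x)⁻¹ * qcsDeriv s v x * (Qcs s x)⁻¹) := by
    filter_upwards [hLQ.continuousAt.eventually_ne h] with x hx
    obtain ⟨L, hL, hv⟩ := exists_hasFDerivAt_inv_Qcs s x hx
    rw [hL.fderiv, hv]
  have hc : Commute (qcsDeriv s v q) (Qcs s q)⁻¹ := (commute_qcsDeriv_Qcs s v q).inv_right₀
  have hd := ((hLP.mul' hLA).mul' hLP).neg
  rw [dir2, (hd.congr_of_eventuallyEq hev).fderiv]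
  simp only [neg_apply, add_apply,
    smul_apply, Pi.mul_apply, smul_eq_mul, hA, hP, MulOpposite.smul_eq_mul_unop,
    MulOpposite.unop_op]
  generalize (Qcs s q)⁻¹ = P at hc ⊢
  generalize qcsDeriv s v q = A at hc ⊢
  have h1 : P * A = A * P := hc.eq.symm
  have h2 : ∀ B, P * (A * B) = A * (P * B) := fun B => by rw [← mul_assoc, h1, mul_assoc]
  simp only [sub_mul, add_mul, mul_neg, neg_mul, mul_assoc, pow_two, h1, h2,
    smul_mul_assoc, mul_smul_comm, one_mul, mul_one, two_mul]
  abel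

theorem sum_qcsDeriv_sq (s q : Quaternion ℝ) :
    qcsDeriv s 1 q ^ 2 + qcsDeriv s e1 q ^ 2 + qcsDeriv s e2 q ^ 2 + qcsDeriv s e3 q ^ 2 =
      (4 : ℝ) • Qcs s q := by
  have hn : ‖q‖ ^ 2 = q.re ^ 2 + q.imI ^ 2 + q.imJ ^ 2 + q.imK ^ 2 := by
    rw [← Quaternion.normSq_eq_norm_mul_self q |>.trans (pow_two _).symm, Quaternion.normSq_def']
  rw [Qcs_eq_smul, hn]
  simp only [qcsDeriv, inner_eq_sum_components]
  ext <;> simp [e1, e2, e3, pow_two] <;> ring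

/-- The function `q ↦ D S_L⁻¹(s,q) = −2(s² − 2Re(q)s + |q|²)⁻¹` is harmonic in the four real
components of `q`: wherever `Q_{c,s}(q) ≠ 0`, the Laplacian of `q ↦ Q_{c,s}(q)⁻¹` vanishes. -/
theorem fueter_cauchyKernel_harmonic (s q : Quaternion ℝ) (h : Qcs s q ≠ 0) :
    quatLaplacian (fun x =>
      (s ^ 2 - 2 * (x.re : Quaternion ℝ) * s + ((‖x‖ ^ 2 : ℝ) : Quaternion ℝ))⁻¹) q = 0 := by
  change quatLaplacian (fun x => (Qcs s x)⁻¹) q = 0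
  have hi1 : inner ℝ (1 : Quaternion ℝ) 1 = (1 : ℝ) := by simp
  have hi2 : inner ℝ e1 e1 = (1 : ℝ) := by rw [inner_eq_sum_components]; simp [e1]
  have hi3 : inner ℝ e2 e2 = (1 : ℝ) := by rw [inner_eq_sum_components]; simp [e2]
  have hi4 : inner ℝ e3 e3 = (1 : ℝ) := by rw [inner_eq_sum_components]; simp [e3]
  simp only [quatLaplacian, dir2_inv_Qcs s _ q h, hi1, hi2, hi3, hi4]
  have hsum : 2 * (qcsDeriv s 1 q ^ 2 + qcsDeriv s e1 q ^ 2 + qcsDeriv s e2 q ^ 2 +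
      qcsDeriv s e3 q ^ 2) * (Qcs s q)⁻¹ = (8 : ℝ) • (1 : Quaternion ℝ) := by
    rw [sum_qcsDeriv_sq, mul_smul_comm, smul_mul_assoc, mul_assoc, mul_inv_cancel₀ h, mul_one, show (2 : Quaternion ℝ) = (2 : ℝ) • 1 by rw [two_smul, one_add_one_eq_two]]
    module
  rw [← add_mul, ← add_mul, ← add_mul]
  convert zero_mul _
  rw [← sub_eq_zero.mpr hsum]
  simp only [mul_add, add_mul]
  module
end
end

section
/- Fix s ∈ ℍ and I ∈ 𝕊, and define g(u,v) := (s² − 2us + u² + v²)^{−1} on the open set of (u,v) ∈ ℝ² where s² − 2us + u² + v² ≠ 0 (i.e. u+Iv ∉ [s]). Then the 2-dimensional Laplacian Δ₂ := (∂_u − I∂_v)∘(∂_u + I∂_v) satisfies Δ₂ g(u,v) = 4·(s² − 2us + u² + v²)^{−2} at every such point. -/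
noncomputable section

open Quaternion Finset

/-- The 2-dimensional Laplacian `Δ₂ = (∂_u − I∂_v)∘(∂_u + I∂_v)`, with `I` acting by left
multiplication. -/
def lap2 (I : Quaternion ℝ) (F : ℝ → ℝ → Quaternion ℝ) (u v : ℝ) : Quaternion ℝ :=
  pd1 (fun a b => pd1 F a b + I * pd2 F a b) u v
    - I * pd2 (fun a b => pd1 F a b + I * pd2 F a b) u v

/-- The denominator `s² − 2us + u² + v²` of the pseudo Cauchy kernel. -/
def pseudoDenom (s : Quaternion ℝ) (a b : ℝ) : Quaternion ℝ :=
  s ^ 2 - 2 * (a : Quaternion ℝ) * s + ((a ^ 2 + b ^ 2 : ℝ) : Quaternion ℝ)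

lemma pseudoDenom_eq (s : Quaternion ℝ) (a b : ℝ) :
    pseudoDenom s a b = s ^ 2 - (2 * a) • s + (a ^ 2 + b ^ 2) • (1 : Quaternion ℝ) := by
  have h2 : (2 : Quaternion ℝ) = ((2 : ℝ) : Quaternion ℝ) := by norm_cast
  rw [pseudoDenom, h2, ← Quaternion.coe_mul, Quaternion.coe_mul_eq_smul,
    ← mul_one (((a ^ 2 + b ^ 2 : ℝ) : Quaternion ℝ)), Quaternion.coe_mul_eq_smul]

lemma hasDerivAt_pseudoDenom_left (s : Quaternion ℝ) (a b : ℝ) :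
    HasDerivAt (fun t => pseudoDenom s t b) ((2 * a) • (1 : Quaternion ℝ) - (2 : ℝ) • s) a := by
  simp only [pseudoDenom_eq]
  have h₁ : HasDerivAt (fun t : ℝ => 2 * t) 2 a := by simpa using (hasDerivAt_id a).const_mul 2
  have h₂ : HasDerivAt (fun t : ℝ => t ^ 2 + b ^ 2) (2 * a) a := by
    simpa using (hasDerivAt_pow 2 a).add_const (b ^ 2)
  exact (((h₁.smul_const s).const_sub (s ^ 2)).add (h₂.smul_const (1 : Quaternion ℝ))).congr_deriv
    (neg_add_eq_sub _ _)

lemma hasDerivAt_pseudoDenom_right (s : Quaternion ℝ) (a b : ℝ) :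
    HasDerivAt (fun t => pseudoDenom s a t) ((2 * b) • (1 : Quaternion ℝ)) b := by
  simp only [pseudoDenom_eq]
  have h : HasDerivAt (fun t : ℝ => a ^ 2 + t ^ 2) (2 * b) b := by
    simpa using (hasDerivAt_pow 2 b).const_add (a ^ 2)
  exact (h.smul_const (1 : Quaternion ℝ)).const_add _

lemma HasDerivAt.quaternion_inv {f : ℝ → Quaternion ℝ} {f' : Quaternion ℝ} {x : ℝ}
    (hf : HasDerivAt f f' x) (hx : f x ≠ 0) :
    HasDerivAt (fun t => (f t)⁻¹) (-((f x)⁻¹ * f' * (f x)⁻¹)) x := by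
  have h := (hasFDerivAt_inv' (𝕜 := ℝ) hx).comp_hasDerivAt x hf
  simp only [neg_apply, ContinuousLinearMap.mulLeftRight_apply] at h
  exact h

lemma hasDerivAt_inv_pseudoDenom_left (s : Quaternion ℝ) {a b : ℝ} (h : pseudoDenom s a b ≠ 0) :
    HasDerivAt (fun t => (pseudoDenom s t b)⁻¹)
      (-((pseudoDenom s a b)⁻¹ * ((2 * a) • (1 : Quaternion ℝ) - (2 : ℝ) • s) *
        (pseudoDenom s a b)⁻¹)) a :=
  (hasDerivAt_pseudoDenom_left s a b).quaternion_inv h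

lemma hasDerivAt_inv_pseudoDenom_right (s : Quaternion ℝ) {a b : ℝ} (h : pseudoDenom s a b ≠ 0) :
    HasDerivAt (fun t => (pseudoDenom s a t)⁻¹)
      (-((pseudoDenom s a b)⁻¹ * ((2 * b) • (1 : Quaternion ℝ)) * (pseudoDenom s a b)⁻¹)) b :=
  (hasDerivAt_pseudoDenom_right s a b).quaternion_inv h

lemma commute_pseudoDenom (s : Quaternion ℝ) (a b : ℝ) : Commute s (pseudoDenom s a b) := by
  rw [pseudoDenom_eq]
  exact (((Commute.refl s).pow_right 2).sub_right ((Commute.refl s).smul_right _)).add_right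
    ((Commute.one_right s).smul_right _)

lemma Quaternion.mul_self_of_re_eq_zero {I : Quaternion ℝ} (hI : I.re = 0) (hI1 : ‖I‖ = 1) :
    I * I = -1 := by
  have h := Quaternion.self_mul_star I
  rw [Quaternion.star_eq_neg.mpr hI, Quaternion.normSq_eq_norm_mul_self, hI1] at h
  rw [← neg_inj, ← mul_neg, h]
  simp

/-- The closed form of `(∂_u + I∂_v)` applied to the inverse of `pseudoDenom`. -/
def pseudoKernelDbar (s I : Quaternion ℝ) (a b : ℝ) : Quaternion ℝ :=
  -((pseudoDenom s a b)⁻¹ * ((2 * a) • (1 : Quaternion ℝ) - (2 : ℝ) • s) *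
      (pseudoDenom s a b)⁻¹) +
    I * -((pseudoDenom s a b)⁻¹ * ((2 * b) • (1 : Quaternion ℝ)) * (pseudoDenom s a b)⁻¹)

/-- For `g(u,v) = (s² − 2us + u² + v²)⁻¹` one has `Δ₂ g(u,v) = 4(s² − 2us + u² + v²)⁻²`
wherever `s² − 2us + u² + v² ≠ 0`. -/
theorem lap2_pseudoKernel (s I : Quaternion ℝ) (hI : I.re = 0) (hI1 : ‖I‖ = 1)
    (u v : ℝ)
    (h : s ^ 2 - 2 * (u : Quaternion ℝ) * s + ((u ^ 2 + v ^ 2 : ℝ) : Quaternion ℝ) ≠ 0) :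
    lap2 I (fun a b =>
        (s ^ 2 - 2 * (a : Quaternion ℝ) * s + ((a ^ 2 + b ^ 2 : ℝ) : Quaternion ℝ))⁻¹) u v
      = 4 * ((s ^ 2 - 2 * (u : Quaternion ℝ) * s + ((u ^ 2 + v ^ 2 : ℝ) : Quaternion ℝ)) ^ 2)⁻¹ := by
  change pseudoDenom s u v ≠ 0 at h
  change lap2 I (fun a b => (pseudoDenom s a b)⁻¹) u v = 4 * ((pseudoDenom s u v) ^ 2)⁻¹
  have hdbar : ∀ a b, pseudoDenom s a b ≠ 0 →
      pd1 (fun a b => (pseudoDenom s a b)⁻¹) a b + I * pd2 (fun a b => (pseudoDenom s a b)⁻¹) a b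
        = pseudoKernelDbar s I a b := fun a b hab => by
    rw [pd1, pd2, (hasDerivAt_inv_pseudoDenom_left s hab).deriv,
      (hasDerivAt_inv_pseudoDenom_right s hab).deriv, pseudoKernelDbar]
  have hu : ∀ᶠ t in nhds u, pseudoDenom s t v ≠ 0 :=
    (hasDerivAt_pseudoDenom_left s u v).continuousAt.eventually_ne h
  have hv : ∀ᶠ t in nhds v, pseudoDenom s u t ≠ 0 :=
    (hasDerivAt_pseudoDenom_right s u v).continuousAt.eventually_ne h
  have h₁ := hasDerivAt_inv_pseudoDenom_left s h
  have h₂ := hasDerivAt_inv_pseudoDenom_right s h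
  have hlin : ∀ x : ℝ, HasDerivAt (fun t : ℝ => (2 * t) • (1 : Quaternion ℝ))
      ((2 : ℝ) • (1 : Quaternion ℝ)) x := fun x => by
    have := (hasDerivAt_id x).const_mul (2 : ℝ)
    simp only [id, mul_one] at this
    exact this.smul_const _
  have d₁ := ((h₁.mul ((hlin u).sub_const ((2 : ℝ) • s))).mul h₁).neg.add
    (((h₁.mul_const ((2 * v) • (1 : Quaternion ℝ))).mul h₁).neg.const_mul I)
  have d₂ := ((h₂.mul_const ((2 * u) • (1 : Quaternion ℝ) - (2 : ℝ) • s)).mul h₂).neg.add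
    (((h₂.mul (hlin v)).mul h₂).neg.const_mul I)
  have e₁ := Filter.EventuallyEq.deriv_eq (hu.mono fun t ht => hdbar t v ht)
  have e₂ := Filter.EventuallyEq.deriv_eq (hv.mono fun t ht => hdbar u t ht)
  rw [lap2, pd1, pd2, e₁, e₂]
  erw [d₁.deriv, d₂.deriv]
  simp only [Pi.mul_apply]
  have hII := Quaternion.mul_self_of_re_eq_zero hI hI1
  set q := pseudoDenom s u v with hq
  have hc : Commute s q⁻¹ := (commute_pseudoDenom s u v).inv_right₀
  set A := (2 * u) • (1 : Quaternion ℝ) - (2 : ℝ) • s with hA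
  have hAc : A * q⁻¹ = q⁻¹ * A :=
    (((Commute.one_left q⁻¹).smul_left _).sub_left (hc.smul_left _)).eq
  have hAA : A * A + (4 * v ^ 2) • (1 : Quaternion ℝ) = (4 : ℝ) • q := by
    rw [hq, pseudoDenom_eq, hA]
    simp only [mul_sub, sub_mul, smul_mul_assoc, mul_smul_comm, one_mul, mul_one, pow_two]
    module
  have hpq : q⁻¹ * q = 1 := inv_mul_cancel₀ h
  have h4 : (4 : Quaternion ℝ) * (q ^ 2)⁻¹ = (4 : ℝ) • (q⁻¹ * q⁻¹) := by
    have : (4 : Quaternion ℝ) = ((4 : ℝ) : Quaternion ℝ) := by norm_cast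
    rw [this, Quaternion.coe_mul_eq_smul, pow_two, mul_inv_rev]
  rw [h4]
  have hAc' : ∀ x, A * (q⁻¹ * x) = q⁻¹ * (A * x) := fun x => by
    rw [← mul_assoc, hAc, mul_assoc]
  have hII' : ∀ x, I * (I * x) = -x := fun x => by rw [← mul_assoc, hII, neg_one_mul]
  simp only [mul_assoc, hAc, hAc', hII', mul_add, add_mul, neg_mul, mul_neg, smul_mul_assoc,
    mul_smul_comm, mul_one, eq_sub_of_add_eq hAA, mul_sub, sub_mul, hpq]
  module
end
end

section
/- Integral representation of axially harmonic functions (ball version): let (aₙ)_{n≥0} ⊂ ℍ and R > r > 0 with ∑_{n=0}^{∞} ‖aₙ‖Rⁿ < ∞, and let f(x) := ∑_{n=0}^{∞} xⁿaₙ for |x| < R (a left slice hyperholomorphic function). Then for every q ∈ ℍ with |q| < r and every J ∈ 𝕊, setting s(θ) := r(cos θ + J sin θ), one has D f(q) = −(1/π)·∫₀^{2π} (s(θ)² − 2Re(q)s(θ) + |q|²)^{−1} · r(cos θ + J sin θ) · f(s(θ)) dθ; in particular the right-hand side does not depend on the choice of J ∈ 𝕊. (The parametrized integral realizes −(1/π)∫_{∂(B_r(0)∩ℂ_J)}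 Q_{c,s}(q)^{−1} ds_J f(s) with ds_J = ds(−J).) -/
noncomputable section

open Quaternion Finset

open MeasureTheory

/-- The real sequence with `u 0 = 0`, `u 1 = 1`, `u (n+2) = 2 t u (n+1) - N u n`. -/
def secondKindSeq (t N : ℝ) : ℕ → ℝ
  | 0 => 0
  | 1 => 1
  | n + 2 => 2 * t * secondKindSeq t N (n + 1) - N * secondKindSeq t N n

lemma normSq_eq_of_quadratic_eq_zero {t N : ℝ} (h : t ^ 2 ≤ N) {z : ℂ}
    (hz : z ^ 2 - 2 * t * z + N = 0) : Complex.normSq z = N := by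
  have h1 := congrArg Complex.re hz
  have h2 := congrArg Complex.im hz
  simp [sq] at h1 h2
  rw [Complex.normSq_apply]
  have h3 : (z.re - t) * z.im = 0 := by linarith
  rcases mul_eq_zero.1 h3 with h4 | h4
  · have h5 : z.re = t := by linarith
    rw [h5] at h1 ⊢
    linarith
  · rw [h4] at h1 ⊢
    have h6 : (z.re - t) ^ 2 = 0 := le_antisymm (by nlinarith) (sq_nonneg _)
    have h7 : z.re = t := by linarith [pow_eq_zero_iff (two_ne_zero) |>.1 h6]
    rw [h7] at h1 ⊢
    nlinarith

lemma quadratic_ne_zero {t N r : ℝ} (h : t ^ 2 ≤ N) (hN : N < r ^ 2) {z : ℂ}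
    (hz : r ^ 2 ≤ ‖z‖ ^ 2) : z ^ 2 - 2 * t * z + N ≠ 0 := by
  intro h0
  have := normSq_eq_of_quadratic_eq_zero h h0
  rw [Complex.normSq_eq_norm_sq] at this
  linarith

lemma reversed_quadratic_ne_zero {t N r : ℝ} (hr : 0 < r) (h : t ^ 2 ≤ N) (hN : N < r ^ 2) {w : ℂ}
    (hw : ‖w‖ ≤ r⁻¹) : 1 - 2 * t * w + N * w ^ 2 ≠ 0 := by
  rcases eq_or_ne w 0 with rfl | h0
  · simp
  have hz : r ≤ ‖w⁻¹‖ := by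
    rw [norm_inv]
    exact (le_inv_comm₀ (norm_pos_iff.2 h0) hr).1 hw
  have := quadratic_ne_zero h hN (z := w⁻¹) (by gcongr)
  contrapose! this
  have h1 : w⁻¹ ^ 2 - 2 * t * w⁻¹ + N = w⁻¹ ^ 2 * (1 - 2 * t * w + N * w ^ 2) := by
    field_simp
  rw [h1, this, mul_zero]

lemma integral_comp_inv_circleMap {g : ℂ → ℂ} {r : ℝ} (hr : 0 < r)
    (hg : ∀ w : ℂ, ‖w‖ ≤ r⁻¹ → DifferentiableAt ℂ g w) :
    ∫ θ in (0 : ℝ)..2 * Real.pi, g (circleMap 0 r θ)⁻¹ = 2 * Real.pi * g 0 := by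
  have hav : Real.circleAverage g 0 r⁻¹ = g 0 := by
    apply circleAverage_of_differentiable_on_off_countable Set.countable_empty
    · intro w hw
      rw [abs_of_pos (by positivity)] at hw
      exact (hg w (by simpa using hw)).continuousAt.continuousWithinAt
    · intro w hw
      rw [abs_of_pos (by positivity)] at hw
      exact hg w (by simpa using (Metric.mem_ball.1 hw.1).le)
  have hinv : ∀ θ : ℝ, (circleMap 0 r θ)⁻¹ = circleMap 0 r⁻¹ (2 * Real.pi - θ) := by
    intro θ
    simp only [circleMap, zero_add, mul_inv, ← Complex.exp_neg]
    push_cast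
    rw [sub_mul, Complex.exp_sub, Complex.exp_two_pi_mul_I, neg_mul_eq_neg_mul, neg_mul,
      Complex.exp_neg, one_div]
  simp_rw [hinv]
  rw [intervalIntegral.integral_comp_sub_left (fun θ => g (circleMap 0 r⁻¹ θ))]
  rw [Real.circleAverage_def] at hav
  rw [sub_self, sub_zero, ← hav, Complex.real_smul]
  push_cast
  field_simp

lemma norm_sq_circleMap_zero (r θ : ℝ) : ‖circleMap 0 r θ‖ ^ 2 = r ^ 2 := by
  simp

lemma circleMap_quadratic_ne_zero {t N r : ℝ} (h : t ^ 2 ≤ N) (hN : N < r ^ 2) (θ : ℝ) :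
    circleMap 0 r θ ^ 2 - 2 * t * circleMap 0 r θ + N ≠ 0 :=
  quadratic_ne_zero h hN (norm_sq_circleMap_zero r θ).ge

lemma continuous_kernel_circleMap {t N r : ℝ} (h : t ^ 2 ≤ N) (hN : N < r ^ 2) :
    Continuous fun θ : ℝ =>
      (circleMap 0 r θ ^ 2 - 2 * t * circleMap 0 r θ + N)⁻¹ * circleMap 0 r θ := by
  have hc := continuous_circleMap 0 r
  exact (Continuous.inv₀ (by fun_prop) (circleMap_quadratic_ne_zero h hN)).mul hc

lemma integral_kernel_circleMap_pow {t N r : ℝ} (hr : 0 < r) (h : t ^ 2 ≤ N) (hN : N < r ^ 2) :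
    ∀ n : ℕ, ∫ θ in (0 : ℝ)..2 * Real.pi,
      (circleMap 0 r θ ^ 2 - 2 * t * circleMap 0 r θ + N)⁻¹ * circleMap 0 r θ *
        circleMap 0 r θ ^ n = 2 * Real.pi * (secondKindSeq t N n : ℂ)
  | 0 => by
    have := integral_comp_inv_circleMap (g := fun w => w * (1 - 2 * t * w + N * w ^ 2)⁻¹) hr
      (fun w hw => differentiableAt_id.mul (DifferentiableAt.inv (by fun_prop)
        (reversed_quadratic_ne_zero hr h hN hw)))
    simp only [zero_mul, mul_zero] at this
    rw [secondKindSeq, Complex.ofReal_zero, mul_zero]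
    refine Eq.trans ?_ this
    refine intervalIntegral.integral_congr fun θ _ => ?_
    have hz : circleMap 0 r θ ≠ 0 := circleMap_ne_center hr.ne'
    have hQ := circleMap_quadratic_ne_zero h hN θ
    generalize circleMap 0 r θ = z at hz hQ
    have : 1 - 2 * t * z⁻¹ + N * z⁻¹ ^ 2 = (z ^ 2 - 2 * t * z + N) * (z ^ 2)⁻¹ := by
      field_simp
    rw [this]
    field_simp
  | 1 => by
    have := integral_comp_inv_circleMap (g := fun w => (1 - 2 * t * w + N * w ^ 2)⁻¹) hr
      (fun w hw => DifferentiableAt.inv (by fun_prop) (reversed_quadratic_ne_zero hr h hN hw))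
    simp only [mul_zero] at this
    rw [secondKindSeq]
    convert this using 1
    · refine intervalIntegral.integral_congr fun θ _ => ?_
      have hz : circleMap 0 r θ ≠ 0 := circleMap_ne_center hr.ne'
      have hQ := circleMap_quadratic_ne_zero h hN θ
      generalize circleMap 0 r θ = z at hz hQ
      have : 1 - 2 * t * z⁻¹ + N * z⁻¹ ^ 2 = (z ^ 2 - 2 * t * z + N) * (z ^ 2)⁻¹ := by
        field_simp
      rw [this]
      field_simp
    · simp
  | n + 2 => by
    have hc := continuous_circleMap 0 r
    have hint : ∀ m : ℕ, IntervalIntegrable (fun θ : ℝ =>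
        (circleMap 0 r θ ^ 2 - 2 * t * circleMap 0 r θ + N)⁻¹ * circleMap 0 r θ *
          circleMap 0 r θ ^ m) volume 0 (2 * Real.pi) := fun m =>
      ((continuous_kernel_circleMap h hN).mul (hc.pow m)).intervalIntegrable _ _
    have h0 : ∫ θ in (0 : ℝ)..2 * Real.pi, circleMap 0 r θ ^ (n + 1) = 0 := by
      have hav := circleAverage_of_differentiable_on_off_countable (f := fun z : ℂ => z ^ (n + 1))
        (c := 0) (R := r) Set.countable_empty (by fun_prop) (by intros; fun_prop)
      rw [Real.circleAverage_def] at hav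
      simpa [Real.pi_ne_zero] using hav
    have hrec : ∀ θ : ℝ, (circleMap 0 r θ ^ 2 - 2 * t * circleMap 0 r θ + N)⁻¹ *
        circleMap 0 r θ * circleMap 0 r θ ^ (n + 2) =
        circleMap 0 r θ ^ (n + 1) +
        (2 * t * ((circleMap 0 r θ ^ 2 - 2 * t * circleMap 0 r θ + N)⁻¹ *
          circleMap 0 r θ * circleMap 0 r θ ^ (n + 1)) -
        N * ((circleMap 0 r θ ^ 2 - 2 * t * circleMap 0 r θ + N)⁻¹ *
          circleMap 0 r θ * circleMap 0 r θ ^ n)) := by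
      intro θ
      have hQ := circleMap_quadratic_ne_zero h hN θ
      generalize circleMap 0 r θ = z at hQ
      have hQ' := inv_mul_cancel₀ hQ
      generalize (z ^ 2 - 2 * t * z + N)⁻¹ = w at hQ'
      linear_combination z ^ (n + 1) * hQ'
    simp_rw [hrec]
    rw [intervalIntegral.integral_add (Continuous.intervalIntegrable (by fun_prop) _ _)
        (((hint _).const_mul _).sub ((hint _).const_mul _)), h0,
      intervalIntegral.integral_sub ((hint _).const_mul _) ((hint _).const_mul _),
      intervalIntegral.integral_const_mul, intervalIntegral.integral_const_mul,
      integral_kernel_circleMap_pow hr h hN n, integral_kernel_circleMap_pow hr h hN (n + 1),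
      secondKindSeq]
    push_cast
    ring

/-- The Fueter operator applied to a linear map, viewed as a derivative. -/
def fueterSymbol (T : Quaternion ℝ →L[ℝ] Quaternion ℝ) : Quaternion ℝ :=
  T 1 + e1 * T e1 + e2 * T e2 + e3 * T e3

lemma fueterL_eq_fueterSymbol (f : Quaternion ℝ → Quaternion ℝ) (q : Quaternion ℝ) :
    fueterL f q = fueterSymbol (fderiv ℝ f q) := rfl

lemma HasSum.fueterSymbol {T : ℕ → Quaternion ℝ →L[ℝ] Quaternion ℝ}
    {T' : Quaternion ℝ →L[ℝ] Quaternion ℝ} (h : HasSum T T') :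
    HasSum (fun n => fueterSymbol (T n)) (_root_.fueterSymbol T') := by
  have hv : ∀ v : Quaternion ℝ, HasSum (fun n => T n v) (T' v) := fun v =>
    h.mapL (ContinuousLinearMap.apply ℝ (Quaternion ℝ) v)
  exact (((hv 1).add ((hv e1).mul_left e1)).add ((hv e2).mul_left e2)).add ((hv e3).mul_left e3)

lemma sum_units_conj (p : Quaternion ℝ) :
    p + e1 * (p * e1) + e2 * (p * e2) + e3 * (p * e3) = -2 * star p := by
  have h2 : (2 : Quaternion ℝ) = ((2 : ℝ) : Quaternion ℝ) := rfl
  have h1 : e1.re = 0 ∧ e1.imI = 1 ∧ e1.imJ = 0 ∧ e1.imK = 0 := ⟨rfl, rfl, rfl, rfl⟩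
  have h3 : e2.re = 0 ∧ e2.imI = 0 ∧ e2.imJ = 1 ∧ e2.imK = 0 := ⟨rfl, rfl, rfl, rfl⟩
  have h4 : e3.re = 0 ∧ e3.imI = 0 ∧ e3.imJ = 0 ∧ e3.imK = 1 := ⟨rfl, rfl, rfl, rfl⟩
  rw [h2]
  ext <;> simp [h1, h3, h4] <;> ring

lemma coe_secondKindSeq_add_two (t N : ℝ) (n : ℕ) :
    (secondKindSeq t N (n + 2) : Quaternion ℝ) =
      ((2 * t : ℝ) : Quaternion ℝ) * (secondKindSeq t N (n + 1) : Quaternion ℝ) -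
        (N : Quaternion ℝ) * (secondKindSeq t N n : Quaternion ℝ) := by
  rw [secondKindSeq, Quaternion.coe_sub, Quaternion.coe_mul, Quaternion.coe_mul N]

lemma secondKindSeq_succ (q : Quaternion ℝ) : ∀ n : ℕ,
    (secondKindSeq q.re (‖q‖ ^ 2) (n + 1) : Quaternion ℝ) =
      (secondKindSeq q.re (‖q‖ ^ 2) n : Quaternion ℝ) * q + star q ^ n
  | 0 => by simp [secondKindSeq]
  | 1 => by
    simp only [secondKindSeq]
    rw [Quaternion.star_eq_two_re_sub]
    simp
  | n + 2 => by
    have hN : ((‖q‖ ^ 2 : ℝ) : Quaternion ℝ) = q * star q := by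
      rw [Quaternion.self_mul_star, Quaternion.normSq_eq_norm_mul_self, sq]
    have hs : star q ^ 2 = ((2 * q.re : ℝ) : Quaternion ℝ) * star q
        - ((‖q‖ ^ 2 : ℝ) : Quaternion ℝ) := by
      rw [hN, sq, ← sub_mul, Quaternion.star_eq_two_re_sub]
    have hq : star q ^ (n + 2) = ((2 * q.re : ℝ) : Quaternion ℝ) * star q ^ (n + 1)
        - ((‖q‖ ^ 2 : ℝ) : Quaternion ℝ) * star q ^ n := by
      rw [add_comm n 2, pow_add, hs, sub_mul, mul_assoc, ← pow_succ']
    have hu := coe_secondKindSeq_add_two q.re (‖q‖ ^ 2)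
    rw [hq, hu (n + 1)]
    conv_rhs => rw [hu n]
    conv_lhs => rw [secondKindSeq_succ q n, secondKindSeq_succ q (n + 1)]
    simp only [mul_add, sub_mul, mul_assoc]
    abel

lemma fderiv_pow_succ_apply (n : ℕ) (x v : Quaternion ℝ) :
    fderiv ℝ (fun y : Quaternion ℝ => y ^ (n + 1)) x v =
      x ^ n * v + fderiv ℝ (fun y : Quaternion ℝ => y ^ n) x v * x := by
  have hd : DifferentiableAt ℝ (fun y : Quaternion ℝ => y ^ n) x := by fun_prop
  have := (hd.hasFDerivAt.mul' (hasFDerivAt_id x)).fderiv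
  have he : (fun y : Quaternion ℝ => y ^ (n + 1)) = (fun y : Quaternion ℝ => y ^ n) * id := by
    ext1 y
    simp [pow_succ]
  rw [he, this]
  simp

lemma norm_fderiv_pow_le (x : Quaternion ℝ) {r R : ℝ} (hxr : ‖x‖ ≤ r) (hrR : r < R) (n : ℕ) :
    ‖fderiv ℝ (fun y : Quaternion ℝ => y ^ n) x‖ ≤ (R ^ n - r ^ n) / (R - r) := by
  have hRr : 0 < R - r := sub_pos.2 hrR
  have hr : 0 ≤ r := (norm_nonneg x).trans hxr
  induction n with
  | zero => exact ContinuousLinearMap.opNorm_le_bound _ (by simp) fun v => by simp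
  | succ n ih =>
    have hpow : r ^ n ≤ R ^ n := by gcongr
    have hB : 0 ≤ (R ^ n - r ^ n) / (R - r) := div_nonneg (by linarith) hRr.le
    have hB' : (R ^ (n + 1) - r ^ (n + 1)) / (R - r) =
        R ^ n + (R ^ n - r ^ n) / (R - r) * r := by
      field_simp
      ring
    refine ContinuousLinearMap.opNorm_le_bound _ ?_ fun v => ?_
    · rw [hB']
      have : 0 ≤ R ^ n := (pow_nonneg hr n).trans hpow
      positivity
    rw [fderiv_pow_succ_apply, hB', add_mul]
    refine (norm_add_le _ _).trans (add_le_add ?_ ?_)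
    · rw [norm_mul, norm_pow]
      gcongr
      exact hxr.trans hrR.le
    · rw [norm_mul, mul_right_comm]
      gcongr
      exact ContinuousLinearMap.le_of_opNorm_le _ ih v

lemma fueterSymbol_fderiv_pow (q : Quaternion ℝ) (n : ℕ) :
    fueterSymbol (fderiv ℝ (fun y : Quaternion ℝ => y ^ n) q) =
      -2 * (secondKindSeq q.re (‖q‖ ^ 2) n : Quaternion ℝ) := by
  induction n with
  | zero => simp [fueterSymbol, secondKindSeq]
  | succ n ih =>
    have hs := sum_units_conj (q ^ n)
    rw [fueterSymbol] at ih ⊢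
    simp only [fderiv_pow_succ_apply]
    rw [secondKindSeq_succ, mul_add (-2 : Quaternion ℝ), ← mul_assoc (-2 : Quaternion ℝ), ← ih, ← star_pow, ← hs]
    noncomm_ring

/-- The derivative of `y ↦ y ^ n * c` at `x`. -/
def powMulDeriv (c : Quaternion ℝ) (n : ℕ) (x : Quaternion ℝ) : Quaternion ℝ →L[ℝ] Quaternion ℝ :=
  ((ContinuousLinearMap.mul ℝ (Quaternion ℝ)).flip c).comp
    (fderiv ℝ (fun y : Quaternion ℝ => y ^ n) x)

lemma powMulDeriv_apply (c : Quaternion ℝ) (n : ℕ) (x v : Quaternion ℝ) :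
    powMulDeriv c n x v = fderiv ℝ (fun y : Quaternion ℝ => y ^ n) x v * c := rfl

lemma hasFDerivAt_pow_mul (c : Quaternion ℝ) (n : ℕ) (x : Quaternion ℝ) :
    HasFDerivAt (fun y : Quaternion ℝ => y ^ n * c) (powMulDeriv c n x) x := by
  have hd : DifferentiableAt ℝ (fun y : Quaternion ℝ => y ^ n) x := by fun_prop
  exact ((ContinuousLinearMap.mul ℝ (Quaternion ℝ)).flip c).hasFDerivAt.comp x hd.hasFDerivAt

lemma norm_powMulDeriv_le (c x : Quaternion ℝ) {r R : ℝ} (hxr : ‖x‖ ≤ r) (hrR : r < R) (n : ℕ) :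
    ‖powMulDeriv c n x‖ ≤ ‖c‖ * R ^ n * (R - r)⁻¹ := by
  have hRr : 0 < R - r := sub_pos.2 hrR
  have hr : 0 ≤ r := (norm_nonneg x).trans hxr
  have hR : 0 ≤ R := hr.trans hrR.le
  refine ContinuousLinearMap.opNorm_le_bound _ (by positivity) fun v => ?_
  have h2 : ‖fderiv ℝ (fun y : Quaternion ℝ => y ^ n) x‖ ≤ R ^ n * (R - r)⁻¹ := by
    refine (norm_fderiv_pow_le x hxr hrR n).trans ?_
    rw [div_eq_mul_inv]
    gcongr
    linarith [pow_nonneg hr n]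
  rw [powMulDeriv_apply, norm_mul]
  calc ‖fderiv ℝ (fun y : Quaternion ℝ => y ^ n) x v‖ * ‖c‖
      ≤ (R ^ n * (R - r)⁻¹ * ‖v‖) * ‖c‖ := by
        gcongr
        exact ContinuousLinearMap.le_of_opNorm_le _ h2 v
    _ = _ := by ring

lemma fueterSymbol_powMulDeriv (c : Quaternion ℝ) (n : ℕ) (q : Quaternion ℝ) :
    fueterSymbol (powMulDeriv c n q) =
      -2 * (secondKindSeq q.re (‖q‖ ^ 2) n : Quaternion ℝ) * c := by
  rw [← fueterSymbol_fderiv_pow, fueterSymbol, fueterSymbol]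
  simp only [powMulDeriv_apply, add_mul, mul_assoc]

lemma summable_clm_of_norm_bounded {E : Type*} [NormedAddCommGroup E] [NormedSpace ℝ E]
    [CompleteSpace E] {T : ℕ → E →L[ℝ] E} {u : ℕ → ℝ} (hu : Summable u) (h : ∀ n, ‖T n‖ ≤ u n) :
    Summable T :=
  Summable.of_norm_bounded hu h

lemma hasSum_fueterL {a : ℕ → Quaternion ℝ} {R : ℝ}
    (ha : Summable (fun n : ℕ => ‖a n‖ * R ^ n)) {f : Quaternion ℝ → Quaternion ℝ}
    (hf : ∀ x : Quaternion ℝ, ‖x‖ < R → f x = ∑' n : ℕ, x ^ n * a n)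
    {q : Quaternion ℝ} (hq : ‖q‖ < R) :
    HasSum (fun n => -2 * (secondKindSeq q.re (‖q‖ ^ 2) n : Quaternion ℝ) * a n)
      (fueterL f q) := by
  obtain ⟨r, hqr, hrR⟩ := exists_between hq
  have hr : 0 < r := (norm_nonneg q).trans_lt hqr
  have hu : Summable fun n => ‖a n‖ * R ^ n * (R - r)⁻¹ := ha.mul_right _
  have hbound : ∀ n x, x ∈ Metric.ball (0 : Quaternion ℝ) r →
      ‖powMulDeriv (a n) n x‖ ≤ ‖a n‖ * R ^ n * (R - r)⁻¹ := fun n x hx =>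
    norm_powMulDeriv_le (a n) x (mem_ball_zero_iff.1 hx).le hrR n
  have h0 : Summable fun n => (0 : Quaternion ℝ) ^ n * a n :=
    summable_of_ne_finset_zero (s := {0}) fun n hn => by
      rw [zero_pow (by simpa using hn), zero_mul]
  have hqmem : q ∈ Metric.ball (0 : Quaternion ℝ) r := mem_ball_zero_iff.2 hqr
  have hder : HasFDerivAt (fun y => ∑' n, y ^ n * a n) (∑' n, powMulDeriv (a n) n q) q :=
    hasFDerivAt_tsum_of_isPreconnected hu Metric.isOpen_ball
      (convex_ball (0 : Quaternion ℝ) r).isPreconnected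
      (fun n x _ => hasFDerivAt_pow_mul (a n) n x) hbound (Metric.mem_ball_self hr) h0 hqmem
  have hder' : HasFDerivAt f (∑' n, powMulDeriv (a n) n q) q := by
    refine hder.congr_of_eventuallyEq ?_
    filter_upwards [Metric.isOpen_ball.mem_nhds hqmem] with x hx
    exact hf x ((mem_ball_zero_iff.1 hx).trans hrR)
  have hsum : Summable fun n => powMulDeriv (a n) n q :=
    summable_clm_of_norm_bounded hu fun n => hbound n q hqmem
  rw [fueterL_eq_fueterSymbol, hder'.fderiv]
  simp_rw [← fueterSymbol_powMulDeriv]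
  exact hsum.hasSum.fueterSymbol

/-- The isometric embedding `ℂ → ℍ` sending `I` to an imaginary unit `J`. -/
lemma exists_algHom_isometry {J : Quaternion ℝ} (hJre : J.re = 0) (hJ1 : ‖J‖ = 1) :
    ∃ φ : ℂ →ₐ[ℝ] Quaternion ℝ,
      (∀ z : ℂ, φ z = (z.re : Quaternion ℝ) + z.im • J) ∧ ∀ z : ℂ, ‖φ z‖ = ‖z‖ := by
  have hJn : Quaternion.normSq J = 1 := by
    rw [Quaternion.normSq_eq_norm_mul_self, hJ1, mul_one]
  have hJ : J * J = -1 := by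
    have h1 := Quaternion.star_mul_self (a := J)
    have h2 : star J = -J := by rw [Quaternion.star_eq_two_re_sub, hJre]; simp
    rw [h2, hJn, neg_mul] at h1
    rw [← neg_eq_iff_eq_neg, h1, Quaternion.coe_one]
  have hφ : ∀ z : ℂ, Complex.lift ⟨J, hJ⟩ z = (z.re : Quaternion ℝ) + z.im • J :=
    fun z => Complex.liftAux_apply J hJ z
  refine ⟨Complex.lift ⟨J, hJ⟩, hφ, fun z => ?_⟩
  rw [← sq_eq_sq₀ (norm_nonneg _) (norm_nonneg _), ← Complex.normSq_eq_norm_sq, sq,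
    ← Quaternion.normSq_eq_norm_mul_self, hφ, Complex.normSq_apply]
  rw [Quaternion.normSq_def'] at hJn ⊢
  simp only [Quaternion.re_add, Quaternion.imI_add, Quaternion.imJ_add, Quaternion.imK_add,
    Quaternion.re_coe, Quaternion.imI_coe, Quaternion.imJ_coe, Quaternion.imK_coe,
    Quaternion.re_smul, Quaternion.imI_smul, Quaternion.imJ_smul, Quaternion.imK_smul,
    smul_eq_mul, hJre] at hJn ⊢
  linear_combination z.im ^ 2 * hJn

lemma Qcs_algHom (φ : ℂ →ₐ[ℝ] Quaternion ℝ) (z : ℂ) (q : Quaternion ℝ) :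
    Qcs (φ z) q = φ (z ^ 2 - 2 * (q.re : ℝ) * z + ((‖q‖ ^ 2 : ℝ) : ℂ)) := by
  have hc : ∀ x : ℝ, φ (x : ℂ) = (x : Quaternion ℝ) := φ.commutes
  rw [Qcs, map_add, map_sub, map_mul, map_mul, map_pow, hc, hc, map_ofNat]

lemma sq_re_le_norm_sq (q : Quaternion ℝ) : q.re ^ 2 ≤ ‖q‖ ^ 2 := by
  rw [sq ‖q‖, ← Quaternion.normSq_eq_norm_mul_self, Quaternion.normSq_def']
  nlinarith [sq_nonneg q.imI, sq_nonneg q.imJ, sq_nonneg q.imK]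

lemma hasSum_integral_kernel {a : ℕ → Quaternion ℝ} {r : ℝ} (hr : 0 < r)
    (ha : Summable (fun n : ℕ => ‖a n‖ * r ^ n)) {q : Quaternion ℝ} (hq : ‖q‖ < r)
    (φ : ℂ →ₐ[ℝ] Quaternion ℝ) (hφ : ∀ z, ‖φ z‖ = ‖z‖) :
    HasSum (fun n => ((2 * Real.pi * secondKindSeq q.re (‖q‖ ^ 2) n : ℝ) : Quaternion ℝ) * a n)
      (∫ θ in (0 : ℝ)..2 * Real.pi, (Qcs (φ (circleMap 0 r θ)) q)⁻¹ * φ (circleMap 0 r θ) *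
        ∑' n, φ (circleMap 0 r θ) ^ n * a n) := by
  have h1 := sq_re_le_norm_sq q
  have h2 : ‖q‖ ^ 2 < r ^ 2 := by gcongr
  set K : ℝ → ℂ := fun θ => (circleMap 0 r θ ^ 2 - 2 * (q.re : ℝ) * circleMap 0 r θ +
    ((‖q‖ ^ 2 : ℝ) : ℂ))⁻¹ * circleMap 0 r θ with hK
  have hKc : Continuous K := continuous_kernel_circleMap h1 h2
  have hzc := continuous_circleMap 0 r
  have hz : ∀ θ, ‖φ (circleMap 0 r θ)‖ = r := fun θ => by rw [hφ]; simp [hr.le]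
  obtain ⟨M, hM⟩ := (isCompact_uIcc (a := (0 : ℝ)) (b := 2 * Real.pi)).exists_bound_of_continuousOn
    hKc.continuousOn
  let L : ℂ →L[ℝ] Quaternion ℝ := φ.toLinearMap.toContinuousLinearMap
  have hφc : Continuous φ := L.continuous
  have hint : ∀ n, ∫ θ in (0 : ℝ)..2 * Real.pi, φ (K θ * circleMap 0 r θ ^ n) * a n =
      ((2 * Real.pi * secondKindSeq q.re (‖q‖ ^ 2) n : ℝ) : Quaternion ℝ) * a n := by
    intro n
    have hL := (((ContinuousLinearMap.mul ℝ (Quaternion ℝ)).flip (a n)).comp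
      L).intervalIntegral_comp_comm ((hKc.mul (hzc.pow n)).intervalIntegrable (μ := volume) 0
        (2 * Real.pi))
    refine hL.trans ((congrArg _ (integral_kernel_circleMap_pow hr h1 h2 n)).trans ?_)
    have hc : ∀ x : ℝ, φ (x : ℂ) = (x : Quaternion ℝ) := φ.commutes
    rw [← hc]
    push_cast
    rfl
  simp_rw [← hint]
  refine intervalIntegral.hasSum_integral_of_dominated_convergence
    (fun n _ => M * (‖a n‖ * r ^ n)) (fun n => ?_) (fun n => ?_) ?_ ?_ ?_
  · exact Continuous.aestronglyMeasurable
      ((hφc.comp (hKc.mul (hzc.pow n))).mul continuous_const)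
  · refine Filter.Eventually.of_forall fun θ hθ => ?_
    rw [norm_mul, map_mul, norm_mul, map_pow, norm_pow, hz, hφ, mul_assoc, mul_comm (r ^ n)]
    gcongr
    exact hM θ (Set.uIoc_subset_uIcc hθ)
  · exact Filter.Eventually.of_forall fun _ _ => ha.mul_left M
  · exact intervalIntegrable_const
  · refine Filter.Eventually.of_forall fun θ _ => ?_
    have hs : Summable fun n => φ (circleMap 0 r θ) ^ n * a n := by
      refine Summable.of_norm_bounded ha fun n => ?_
      rw [norm_mul, norm_pow, hz, mul_comm]
    have he : ∀ n, φ (K θ * circleMap 0 r θ ^ n) * a n =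
        (Qcs (φ (circleMap 0 r θ)) q)⁻¹ * φ (circleMap 0 r θ) *
          (φ (circleMap 0 r θ) ^ n * a n) := fun n => by
      rw [Qcs_algHom, ← map_inv₀, ← map_mul, map_mul, map_pow, mul_assoc]
    simp_rw [he]
    exact hs.hasSum.mul_left _

/-- Integral representation of axially harmonic functions, ball version: if
`f(x) = ∑_{n} xⁿ aₙ` converges for `|x| < R` and `|q| < r < R`, then for every imaginary unit
`J ∈ 𝕊`, parametrizing `∂(B_r(0) ∩ ℂ_J)` by `s(θ) = r(cos θ + J sin θ)`,
`D f(q) = −(1/π) ∫₀^{2π} Q_{c,s(θ)}(q)⁻¹ · r(cos θ + J sin θ) · f(s(θ)) dθ`. -/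
theorem harmonic_integral_representation_ball
    (a : ℕ → Quaternion ℝ) (R r : ℝ) (hr : 0 < r) (hrR : r < R)
    (ha : Summable (fun n : ℕ => ‖a n‖ * R ^ n))
    (f : Quaternion ℝ → Quaternion ℝ)
    (hf : ∀ x : Quaternion ℝ, ‖x‖ < R → f x = ∑' n : ℕ, x ^ n * a n)
    (q : Quaternion ℝ) (hq : ‖q‖ < r)
    (J : Quaternion ℝ) (hJre : J.re = 0) (hJ1 : ‖J‖ = 1) :
    fueterL f q = -(1 / Real.pi) •
      ∫ θ in (0 : ℝ)..(2 * Real.pi),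
        (Qcs (((r * Real.cos θ : ℝ) : Quaternion ℝ) + (r * Real.sin θ) • J) q)⁻¹ *
          (((r * Real.cos θ : ℝ) : Quaternion ℝ) + (r * Real.sin θ) • J) *
          f (((r * Real.cos θ : ℝ) : Quaternion ℝ) + (r * Real.sin θ) • J) := by
  obtain ⟨φ, hφ, hφn⟩ := exists_algHom_isometry hJre hJ1
  have hs : ∀ θ : ℝ, ((r * Real.cos θ : ℝ) : Quaternion ℝ) + (r * Real.sin θ) • J =
      φ (circleMap 0 r θ) := by
    intro θ
    rw [hφ]
    simp [circleMap_zero, Complex.exp_ofReal_mul_I_re, Complex.exp_ofReal_mul_I_im]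
  have har : Summable fun n => ‖a n‖ * r ^ n :=
    Summable.of_nonneg_of_le (fun n => by positivity) (fun n => by gcongr) ha
  have hfs : ∀ θ : ℝ, f (φ (circleMap 0 r θ)) = ∑' n, φ (circleMap 0 r θ) ^ n * a n := by
    intro θ
    refine hf _ ?_
    rw [hφn]
    simpa [abs_of_pos hr] using hrR
  simp_rw [hs, hfs]
  refine (hasSum_fueterL ha hf (hq.trans hrR)).unique ?_
  convert (hasSum_integral_kernel hr har hq φ hφn).const_smul (-(1 / Real.pi)) using 2 with n
  rw [← Quaternion.coe_mul_eq_smul, ← mul_assoc, ← Quaternion.coe_mul]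
  congr 1
  have h2 : (-2 : Quaternion ℝ) = ((-2 : ℝ) : Quaternion ℝ) := by
    rw [Quaternion.coe_neg]; rfl
  rw [h2, ← Quaternion.coe_mul]
  congr 1
  field_simp
end
end
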